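/- arXiv:2203.02283 — 11 statements merged into one kernel-verified Lean document; each statement's English description precedes it below -/
import Mathlib

section
/- Let a, b, m, n be positive integers and let M be an m×n (0,1)-matrix that is (a,b)-admissible. If c_1, …, c_n denote the column sums of M, then ∑_{j=1}^{n} C(c_j, a) ≤ (b−1)·C(m, a), where C(·,·) denotes the binomial coefficient. -/
/-- An `m × n` (0,1)-matrix (entries as `Bool`) is `(a,b)`-admissible if it contains no
all-one `a × b` minor. -/
def Admissible {m n : ℕ} (a b : ℕ) (M : Fin m → Fin n → Bool) : Prop :=
  ¬ ∃ (R : Finset (Fin m)) (C : Finset (Fin n)),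
      R.card = a ∧ C.card = b ∧ ∀ i ∈ R, ∀ j ∈ C, M i j = true

/-- The sum of column `j` of a (0,1)-matrix: the number of ones in that column. -/
def colSum {m n : ℕ} (M : Fin m → Fin n → Bool) (j : Fin n) : ℕ :=
  (Finset.univ.filter fun i : Fin m => M i j = true).card

theorem stmt0 (a b m n : ℕ) (ha : 0 < a) (hb : 0 < b) (hm : 0 < m) (hn : 0 < n)
    (M : Fin m → Fin n → Bool) (hM : Admissible a b M) :
    ∑ j : Fin n, Nat.choose (colSum M j) a ≤ (b - 1) * Nat.choose m a := by
  classical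
  let S (R : Finset (Fin m)) (j : Fin n) : Prop := ∀ i ∈ R, M i j = true
  have hcol (j : Fin n) : Nat.choose (colSum M j) a =
      (((Finset.univ : Finset (Fin m)).powersetCard a).filter fun R => S R j).card := by
    rw [colSum, ← Finset.card_powersetCard]
    congr 1
    ext R
    simp [S, Finset.mem_powersetCard, Finset.subset_iff, and_comm]
  have hrow : ∀ R ∈ (Finset.univ : Finset (Fin m)).powersetCard a,
      (Finset.univ.filter fun j => S R j).card ≤ b - 1 := by
    intro R hR
    by_contra! h
    obtain ⟨C, hC, hCb⟩ := Finset.exists_subset_card_eq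
      (show b ≤ (Finset.univ.filter fun j => S R j).card by omega)
    exact hM ⟨R, C, (Finset.mem_powersetCard.mp hR).2, hCb,
      fun i hi j hj => (Finset.mem_filter.mp (hC hj)).2 i hi⟩
  calc ∑ j : Fin n, Nat.choose (colSum M j) a
      = ∑ R ∈ (Finset.univ : Finset (Fin m)).powersetCard a,
          (Finset.univ.filter fun j => S R j).card := by
        simp_rw [hcol, Finset.card_filter]
        exact Finset.sum_comm
    _ ≤ ((Finset.univ : Finset (Fin m)).powersetCard a).card • (b - 1) :=
        Finset.sum_le_card_nsmul _ _ _ hrow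
    _ = (b - 1) * Nat.choose m a := by
        rw [Finset.card_powersetCard, Finset.card_univ, Fintype.card_fin, smul_eq_mul, mul_comm]
end

section
/- Let a, b, m, n be positive integers with 1 ≤ a ≤ m, b ≥ 2, and n ≥ (b−1)·C(m, a). Then z_{a,b}(m, n) = (a−1)·n + (b−1)·C(m, a), where C(·,·) denotes the binomial coefficient. -/
/-- The number of ones in a (0,1)-matrix. -/
def onesCount {m n : ℕ} (M : Fin m → Fin n → Bool) : ℕ :=
  (Finset.univ.filter fun p : Fin m × Fin n => M p.1 p.2 = true).card

/-- The Zarankiewicz function `z_{a,b}(m,n)`: the maximum number of ones in an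
`(a,b)`-admissible `m × n` (0,1)-matrix. -/
noncomputable def zar (a b m n : ℕ) : ℕ :=
  sSup {k | ∃ M : Fin m → Fin n → Bool, Admissible a b M ∧ onesCount M = k}

theorem onesCount_eq_sum_card {m n : ℕ} (M : Fin m → Fin n → Bool) :
    onesCount M = ∑ j, (Finset.univ.filter fun i => M i j = true).card := by
  simp only [onesCount, Finset.card_filter]
  rw [Fintype.sum_prod_type_right]

theorem Nat.le_pred_add_choose (a d : ℕ) (ha : 1 ≤ a) : d ≤ (a - 1) + d.choose a := by
  obtain ⟨a, rfl⟩ := Nat.exists_eq_add_of_le' ha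
  induction d with
  | zero => exact Nat.zero_le _
  | succ d ih =>
    rw [Nat.choose_succ_succ']
    rcases le_or_gt a d with h | h
    · have := Nat.choose_pos h
      omega
    · omega

/-- Double counting of pairs (column, `a`-set of ones in that column). -/
theorem Admissible.sum_choose_le {a b m n : ℕ} {M : Fin m → Fin n → Bool}
    (hM : Admissible a b M) (hb : 1 ≤ b) :
    ∑ j, (Finset.univ.filter fun i => M i j = true).card.choose a ≤ (b - 1) * m.choose a := by
  classical
  have hrow : ∀ R ∈ Finset.powersetCard a (Finset.univ : Finset (Fin m)),
      (Finset.univ.filter fun j => ∀ i ∈ R, M i j = true).card ≤ b - 1 := by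
    intro R hR
    by_contra hlt
    obtain ⟨C, hC, hCb⟩ := Finset.exists_subset_card_eq
      (show b ≤ (Finset.univ.filter fun j => ∀ i ∈ R, M i j = true).card by omega)
    exact hM ⟨R, C, (Finset.mem_powersetCard.1 hR).2, hCb,
      fun i hi j hj => (Finset.mem_filter.1 (hC hj)).2 i hi⟩
  have hcol : ∀ j, (Finset.univ.filter fun i => M i j = true).card.choose a =
      ((Finset.powersetCard a (Finset.univ : Finset (Fin m))).filter
        fun R => ∀ i ∈ R, M i j = true).card := by
    intro j
    rw [← Finset.card_powersetCard]
    congr 1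
    ext R
    simp [Finset.mem_powersetCard, Finset.subset_iff, and_comm]
  calc ∑ j, (Finset.univ.filter fun i => M i j = true).card.choose a
      = ∑ R ∈ Finset.powersetCard a (Finset.univ : Finset (Fin m)),
          (Finset.univ.filter fun j => ∀ i ∈ R, M i j = true).card := by
        rw [Finset.sum_congr rfl fun j _ => hcol j]
        simp only [Finset.card_filter]
        exact Finset.sum_comm
    _ ≤ ∑ R ∈ Finset.powersetCard a (Finset.univ : Finset (Fin m)), (b - 1) :=
        Finset.sum_le_sum hrow
    _ = (b - 1) * m.choose a := by simp [mul_comm]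

theorem Admissible.onesCount_le {a b m n : ℕ} {M : Fin m → Fin n → Bool}
    (hM : Admissible a b M) (ha : 1 ≤ a) (hb : 1 ≤ b) :
    onesCount M ≤ (a - 1) * n + (b - 1) * m.choose a := by
  rw [onesCount_eq_sum_card]
  calc ∑ j, (Finset.univ.filter fun i => M i j = true).card
      ≤ ∑ j, ((a - 1) + (Finset.univ.filter fun i => M i j = true).card.choose a) :=
        Finset.sum_le_sum fun j _ => Nat.le_pred_add_choose a _ ha
    _ = (a - 1) * n + ∑ j, (Finset.univ.filter fun i => M i j = true).card.choose a := by
        simp [Finset.sum_add_distrib, mul_comm]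
    _ ≤ _ := Nat.add_le_add_left (hM.sum_choose_le hb) _

/-- Use every `a`-set as the support of exactly `b - 1` columns, and give every remaining column
`a - 1` ones. -/
theorem exists_admissible_onesCount_eq {a b m n : ℕ} (ha : 1 ≤ a) (ham : a ≤ m) (hb : 1 ≤ b)
    (hn : (b - 1) * m.choose a ≤ n) :
    ∃ M : Fin m → Fin n → Bool, Admissible a b M ∧
      onesCount M = (a - 1) * n + (b - 1) * m.choose a := by
  classical
  let P := {R : Finset (Fin m) // R ∈ Finset.powersetCard a (Finset.univ : Finset (Fin m))}
  have hcard : Fintype.card (Fin (b - 1) × P) = (b - 1) * m.choose a := by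
    simp [P, Fintype.card_prod]
  obtain ⟨g⟩ : Nonempty (Fin (b - 1) × P ↪ Fin n) :=
    Function.Embedding.nonempty_of_card_le (by rw [hcard, Fintype.card_fin]; exact hn)
  obtain ⟨U, -, hU⟩ := Finset.exists_subset_card_eq
    (show a - 1 ≤ (Finset.univ : Finset (Fin m)).card by rw [Finset.card_fin]; omega)
  have hP : ∀ R : P, R.1.card = a := fun R => (Finset.mem_powersetCard.1 R.2).2
  let S : Fin n → Finset (Fin m) := fun j => if h : ∃ x, g x = j then h.choose.2.1 else U
  have hSg : ∀ x, S (g x) = x.2.1 := by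
    intro x
    have h : ∃ y, g y = g x := ⟨x, rfl⟩
    simp only [S, dif_pos h, g.injective h.choose_spec]
  have hSU : ∀ j, (¬ ∃ x, g x = j) → S j = U := fun j h => dif_neg h
  have hScard : ∀ j, (S j).card = (a - 1) + if j ∈ Finset.univ.map g then 1 else 0 := by
    intro j
    by_cases h : ∃ x, g x = j
    · obtain ⟨x, rfl⟩ := h
      rw [hSg, hP, if_pos (Finset.mem_map_of_mem g (Finset.mem_univ x))]
      omega
    · rw [hSU j h, hU, if_neg (by simpa using h), add_zero]
  refine ⟨fun i j => decide (i ∈ S j), ?_, ?_⟩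
  · rintro ⟨R, C, hR, hC, hRC⟩
    have hsub : C ⊆ Finset.univ.image
        fun k : Fin (b - 1) => g (k, ⟨R, Finset.mem_powersetCard.2 ⟨R.subset_univ, hR⟩⟩) := by
      intro j hj
      have hRS : R ⊆ S j := fun i hi => of_decide_eq_true (hRC i hi j hj)
      by_cases h : ∃ x, g x = j
      · obtain ⟨⟨k, T⟩, rfl⟩ := h
        rw [hSg] at hRS
        have hRT : R = T.1 := Finset.eq_of_subset_of_card_le hRS (by rw [hP, hR])
        subst hRT
        exact Finset.mem_image.2 ⟨k, Finset.mem_univ k, rfl⟩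
      · have := Finset.card_le_card hRS
        rw [hSU j h, hU] at this
        omega
    have hle := (Finset.card_le_card hsub).trans Finset.card_image_le
    rw [hC, Finset.card_fin] at hle
    omega
  · rw [onesCount_eq_sum_card]
    simp only [decide_eq_true_eq, Finset.filter_univ_mem, hScard, Finset.sum_add_distrib]
    rw [← Finset.card_filter, Finset.filter_univ_mem, Finset.card_map, Finset.card_univ, hcard]
    simp [mul_comm]

theorem stmt2 (a b m n : ℕ) (ha : 1 ≤ a) (ham : a ≤ m) (hb : 2 ≤ b) (hn : 0 < n)
    (hnbig : (b - 1) * Nat.choose m a ≤ n) :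
    zar a b m n = (a - 1) * n + (b - 1) * Nat.choose m a := by
  refine IsGreatest.csSup_eq ⟨exists_admissible_onesCount_eq ha ham (by omega) hnbig, ?_⟩
  rintro _ ⟨M, hM, rfl⟩
  exact hM.onesCount_le ha (by omega)
end

section
/- Let a ≥ 2 and b, m, n be positive integers, let M be an (a,b)-admissible m×n (0,1)-matrix, and fix any row r of M. If the ones of row r lie in columns j_1, …, j_k with column sums c_{j_1}, …, c_{j_k}, then ∑_{i=1}^{k} C(c_{j_i} − 1, a−1) ≤ (b−1)·C(m−1, a−1), where C(·,·) denotes the binomial coefficient. -/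
theorem stmt3 (a b m n : ℕ) (ha : 2 ≤ a) (hb : 0 < b) (hm : 0 < m) (hn : 0 < n)
    (M : Fin m → Fin n → Bool) (hM : Admissible a b M) (r : Fin m) :
    ∑ j ∈ Finset.univ.filter (fun j : Fin n => M r j = true),
        Nat.choose (colSum M j - 1) (a - 1) ≤ (b - 1) * Nat.choose (m - 1) (a - 1) := by
  classical
  set cols := Finset.univ.filter (fun j : Fin n => M r j = true)
  set sets := Finset.powersetCard (a - 1) (Finset.univ.erase r)
  let Full : Fin n → Finset (Fin m) → Prop := fun j S => ∀ i ∈ S, M i j = true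
  have card_above : ∀ j ∈ cols,
      Nat.choose (colSum M j - 1) (a - 1) = (sets.bipartiteAbove Full j).card := by
    intro j hj
    have hr : r ∈ Finset.univ.filter fun i : Fin m => M i j = true := by
      simpa [cols] using hj
    have key : sets.bipartiteAbove Full j =
        Finset.powersetCard (a - 1) ((Finset.univ.filter fun i => M i j = true).erase r) := by
      ext S
      simp only [Finset.mem_bipartiteAbove, Finset.mem_powersetCard, sets, Full,
        Finset.subset_iff, Finset.mem_erase, Finset.mem_filter, Finset.mem_univ, true_and,
        and_true]
      grind
    rw [key, Finset.card_powersetCard, Finset.card_erase_of_mem hr, colSum]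
  have card_below : ∀ S ∈ sets, (cols.bipartiteBelow Full S).card ≤ b - 1 := by
    intro S hS
    obtain ⟨hSr, hcard⟩ := Finset.mem_powersetCard.mp hS
    by_contra! h
    obtain ⟨C, hC, hCb⟩ := Finset.exists_subset_card_eq 
      (show b ≤ (cols.bipartiteBelow Full S).card by omega)
    have hrS : r ∉ S := fun hr => Finset.notMem_erase r _ (hSr hr)
    refine hM ⟨insert r S, C, ?_, hCb, ?_⟩
    · rw [Finset.card_insert_of_notMem hrS]
      omega
    · intro i hi j hj
      obtain ⟨hj₁, hj₂⟩ := (Finset.mem_bipartiteBelow Full).mp (hC hj)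
      rcases Finset.mem_insert.mp hi with rfl | hi
      · exact (Finset.mem_filter.mp hj₁).2
      · exact hj₂ i hi
  calc ∑ j ∈ cols, Nat.choose (colSum M j - 1) (a - 1)
      = ∑ j ∈ cols, (sets.bipartiteAbove Full j).card := Finset.sum_congr rfl card_above
    _ = ∑ S ∈ sets, (cols.bipartiteBelow Full S).card :=
      Finset.sum_card_bipartiteAbove_eq_sum_card_bipartiteBelow Full
    _ ≤ sets.card • (b - 1) := Finset.sum_le_card_nsmul _ _ _ card_below
    _ = (b - 1) * Nat.choose (m - 1) (a - 1) := by
      simp [sets, Finset.card_erase_of_mem, mul_comm]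
end

section
/- For all positive integers a, b, m with a + 1 ≤ m and b ≥ 1, T_{a,b}(m) ≤ ⌊ (m / (a+1)) · ⌊ ((b−1)/a) · C(m−1, a−1) ⌋ ⌋, where the floors denote integer division and C(·,·) the binomial coefficient. -/
/-- `C` is a valid collection for `T_{a,b}(m)`: a multiset of `(a+1)`-element subsets of an
`m`-element set such that every `a`-element subset is contained in at most `b-1` members
of `C` (counted with multiplicity). -/
def IsTCollection (a b m : ℕ) (C : Multiset (Finset (Fin m))) : Prop :=
  (∀ s ∈ C, s.card = a + 1) ∧
    ∀ t : Finset (Fin m), t.card = a → (C.filter fun s => t ⊆ s).card ≤ b - 1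

/-- `T_{a,b}(m)`: the largest size (with multiplicity) of such a collection. -/
noncomputable def Tab (a b m : ℕ) : ℕ :=
  sSup {k | ∃ C : Multiset (Finset (Fin m)), IsTCollection a b m C ∧ Multiset.card C = k}

namespace Multiset

/-- Double counting of a relation between a finset and a multiset. -/
theorem sum_card_filter_eq_sum_map_card_filter {α β : Type*} (F : Finset α) (C : Multiset β)
    (r : α → β → Prop) [∀ t s, Decidable (r t s)] :
    ∑ t ∈ F, (C.filter (r t)).card = (C.map fun s => (F.filter fun t => r t s).card).sum := by
  induction C using Multiset.induction_on with
  | empty => simp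
  | cons s C ih =>
    simp only [filter_cons, card_add, Finset.sum_add_distrib, map_cons, sum_cons, ih,
      Finset.card_filter]
    congr 1
    refine Finset.sum_congr rfl fun t _ => ?_
    split_ifs <;> simp

end Multiset

/-- The number of `(k + 1)`-element subsets of `s` through a point `x ∈ s`. -/
theorem Finset.card_filter_mem_powersetCard_succ {α : Type*} [DecidableEq α] {s : Finset α}
    {x : α} (hx : x ∈ s) (k : ℕ) :
    ((s.powersetCard (k + 1)).filter (x ∈ ·)).card = (s.card - 1).choose k := by
  rw [← card_erase_of_mem hx, ← card_powersetCard]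
  refine card_nbij' (fun t => t.erase x) (fun t => insert x t) ?_ ?_ ?_ ?_
  · intro t ht
    simp only [mem_coe, mem_filter, mem_powersetCard] at ht ⊢
    exact ⟨erase_subset_erase x ht.1.1, by rw [card_erase_of_mem ht.2, ht.1.2]; rfl⟩
  · intro t ht
    simp only [mem_coe, mem_filter, mem_powersetCard] at ht ⊢
    have hxt : x ∉ t := fun h => notMem_erase x s (ht.1 h)
    exact ⟨⟨insert_subset hx (ht.1.trans (erase_subset x s)),
      by rw [card_insert_of_notMem hxt, ht.2]⟩, mem_insert_self x t⟩
  · intro t ht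
    exact insert_erase (mem_filter.1 (mem_coe.1 ht)).2
  · intro t ht
    exact erase_insert fun h => notMem_erase x s ((mem_powersetCard.1 (mem_coe.1 ht)).1 h)

/-- Each point lies in at most `⌊(b - 1) * C(m - 1, a - 1) / a⌋` members of a valid collection. -/
theorem IsTCollection.card_filter_mem_le {a b m : ℕ} {C : Multiset (Finset (Fin m))}
    (hC : IsTCollection a b m C) (ha : 0 < a) (x : Fin m) :
    (C.filter (x ∈ ·)).card ≤ (b - 1) * (m - 1).choose (a - 1) / a := by
  obtain ⟨k, rfl⟩ : ∃ k, a = k + 1 := ⟨a - 1, by omega⟩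
  rw [Nat.le_div_iff_mul_le ha]
  let F : Finset (Finset (Fin m)) := (Finset.univ.powersetCard (k + 1)).filter (x ∈ ·)
  let D := C.filter (x ∈ ·)
  have hD : ∀ s ∈ D, (F.filter (· ⊆ s)).card = k + 1 := by
    intro s hs
    obtain ⟨hsC, hxs⟩ := Multiset.mem_filter.1 hs
    have hF : F.filter (· ⊆ s) = (s.powersetCard (k + 1)).filter (x ∈ ·) := by
      ext t
      simp only [F, Finset.mem_filter, Finset.mem_powersetCard, Finset.subset_univ]
      tauto
    rw [hF, Finset.card_filter_mem_powersetCard_succ hxs, hC.1 s hsC]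
    simp
  calc D.card * (k + 1)
      = (D.map fun s => (F.filter (· ⊆ s)).card).sum := by
        rw [Multiset.map_congr rfl hD]; simp
    _ = ∑ t ∈ F, (D.filter (t ⊆ ·)).card :=
        (Multiset.sum_card_filter_eq_sum_map_card_filter F D (· ⊆ ·)).symm
    _ ≤ ∑ _t ∈ F, (b - 1) := by
        refine Finset.sum_le_sum fun t ht => le_trans (Multiset.card_le_card ?_) (hC.2 t ?_)
        · exact Multiset.filter_le_filter _ (Multiset.filter_le _ _)
        · exact (Finset.mem_powersetCard.1 (Finset.mem_filter.1 ht).1).2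
    _ = (b - 1) * (m - 1).choose k := by
        rw [Finset.sum_const, Finset.card_filter_mem_powersetCard_succ (Finset.mem_univ x),
          Finset.card_univ, Fintype.card_fin, smul_eq_mul, mul_comm]

theorem stmt5 (a b m : ℕ) (ha : 0 < a) (hb : 1 ≤ b) (hm : 0 < m) (ham : a + 1 ≤ m) :
    Tab a b m ≤ m * ((b - 1) * Nat.choose (m - 1) (a - 1) / a) / (a + 1) := by
  refine csSup_le' ?_
  rintro _ ⟨C, hC, rfl⟩
  rw [Nat.le_div_iff_mul_le a.succ_pos]
  have hcard : ∀ s ∈ C, (Finset.univ.filter (· ∈ s)).card = a + 1 := by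
    intro s hs
    simpa using hC.1 s hs
  calc C.card * (a + 1)
      = (C.map fun s => (Finset.univ.filter (· ∈ s)).card).sum := by
        rw [Multiset.map_congr rfl hcard]; simp
    _ = ∑ x, (C.filter (x ∈ ·)).card :=
        (Multiset.sum_card_filter_eq_sum_map_card_filter Finset.univ C (· ∈ ·)).symm
    _ ≤ ∑ _x : Fin m, (b - 1) * (m - 1).choose (a - 1) / a :=
        Finset.sum_le_sum fun x _ => hC.card_filter_mem_le ha x
    _ = m * ((b - 1) * (m - 1).choose (a - 1) / a) := by simp
end

section
/- For every m×n (0,1)-matrix A there exist a permutation σ of the row indices and a permutation τ of the column indices such that in the permuted matrix A' (with A'_{ij} = A_{σ(i)τ(j)}) the rows are in non-increasing lexicographic order and simultaneously the columns are in non-increasing lexicographic order. -/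
/-- Lexicographic comparison of two (0,1)-vectors (`Bool`-valued, with `false < true`),
reading entries in order of increasing index: `r ≤ s` lexicographically. -/
def LexLe {n : ℕ} (r s : Fin n → Bool) : Prop :=
  r = s ∨ ∃ j : Fin n, (∀ k : Fin n, k < j → r k = s k) ∧ r j < s j

/-- The integer whose binary expansion, most significant digit first, is `r`. -/
def binaryValue {n : ℕ} (r : Fin n → Bool) : ℤ :=
  ∑ j, 2 ^ (j.rev : ℕ) * ((r j).toNat : ℤ)

lemma binaryValue_succ {n : ℕ} (r : Fin (n + 1) → Bool) :
    binaryValue r = 2 ^ n * ((r 0).toNat : ℤ) + binaryValue (fun j => r j.succ) := by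
  simp [binaryValue, Fin.sum_univ_succ]

lemma binaryValue_nonneg {n : ℕ} (r : Fin n → Bool) : 0 ≤ binaryValue r :=
  Finset.sum_nonneg fun _ _ => by positivity

lemma binaryValue_lt {n : ℕ} (r : Fin n → Bool) : binaryValue r < 2 ^ n := by
  induction n with
  | zero => simp [binaryValue]
  | succ n ih =>
    rw [binaryValue_succ, pow_succ]
    have h := ih fun j => r j.succ
    cases r 0 <;> simp <;> linarith [binaryValue_nonneg fun j => r j.succ]

lemma LexLe.cons {n : ℕ} {r s : Fin (n + 1) → Bool} (h0 : r 0 = s 0)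
    (h : LexLe (fun j => r j.succ) (fun j => s j.succ)) : LexLe r s := by
  rcases h with h | ⟨j, hj, hlt⟩
  · left
    funext k
    exact Fin.cases h0 (fun k => congrFun h k) k
  · refine Or.inr ⟨j.succ, fun k => ?_, hlt⟩
    exact Fin.cases (fun _ => h0) (fun k hk => hj k (Fin.succ_lt_succ_iff.mp hk)) k

lemma lexLe_of_binaryValue_le {n : ℕ} {r s : Fin n → Bool}
    (h : binaryValue r ≤ binaryValue s) : LexLe r s := by
  induction n with
  | zero => exact Or.inl (Subsingleton.elim _ _)
  | succ n ih =>
    rw [binaryValue_succ, binaryValue_succ] at h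
    have hr := binaryValue_nonneg fun j => r j.succ
    have hs := binaryValue_lt fun j => s j.succ
    rcases lt_trichotomy (r 0) (s 0) with h0 | h0 | h0
    · exact Or.inr ⟨0, fun k hk => absurd hk (Fin.not_lt_zero k), h0⟩
    · rw [h0] at h
      exact LexLe.cons h0 (ih (by linarith))
    · obtain ⟨hs0, hr0⟩ := Bool.lt_iff.mp h0
      simp only [hs0, hr0, Bool.toNat_true, Bool.toNat_false] at h
      push_cast at h
      linarith

/-- A converse to the rearrangement inequality. -/
lemma le_of_forall_sum_mul_comp_perm_le {ι : Type*} [Fintype ι] [DecidableEq ι] {u f : ι → ℤ}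
    (h : ∀ π : Equiv.Perm ι, ∑ i, u i * f (π i) ≤ ∑ i, u i * f i)
    {a b : ι} (hu : u b < u a) : f b ≤ f a := by
  have hab : a ≠ b := by rintro rfl; exact lt_irrefl _ hu
  have hsum : ∑ i, (u i * f i - u i * f (Equiv.swap a b i)) =
      (u a * f a - u a * f b) + (u b * f b - u b * f a) := by
    rw [Fintype.sum_eq_add a b hab]
    · simp
    · rintro x ⟨hxa, hxb⟩
      simp [Equiv.swap_apply_of_ne_of_ne hxa hxb]
  rw [Finset.sum_sub_distrib] at hsum
  nlinarith [h (Equiv.swap a b)]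

/-- The sum of the entries, with weights decreasing geometrically along rows and columns. -/
def weightedSum {m n : ℕ} (A : Fin m → Fin n → Bool) : ℤ :=
  ∑ i, 2 ^ (i.rev : ℕ) * binaryValue (A i)

lemma weightedSum_transpose {m n : ℕ} (A : Fin m → Fin n → Bool) :
    weightedSum (fun j i => A i j) = weightedSum A := by
  simp only [weightedSum, binaryValue, Finset.mul_sum]
  rw [Finset.sum_comm]
  exact Finset.sum_congr rfl fun _ _ => Finset.sum_congr rfl fun _ _ => mul_left_comm _ _ _

lemma lexLe_rows_of_weightedSum_max {m n : ℕ} {A : Fin m → Fin n → Bool}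
    (h : ∀ π : Equiv.Perm (Fin m), weightedSum (fun i => A (π i)) ≤ weightedSum A)
    {i₁ i₂ : Fin m} (hi : i₁ ≤ i₂) : LexLe (A i₂) (A i₁) := by
  rcases hi.eq_or_lt with rfl | hi
  · exact Or.inl rfl
  · refine lexLe_of_binaryValue_le
      (le_of_forall_sum_mul_comp_perm_le (u := fun i : Fin m => 2 ^ (i.rev : ℕ))
        (f := fun i => binaryValue (A i)) h ?_)
    exact pow_lt_pow_right₀ one_lt_two (Fin.rev_lt_rev.mpr hi)

/-- Every (0,1)-matrix can be row- and column-permuted so that its rows are in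
non-increasing lexicographic order and simultaneously its columns are in
non-increasing lexicographic order. -/
theorem stmt6 (m n : ℕ) (A : Fin m → Fin n → Bool) :
    ∃ (σ : Equiv.Perm (Fin m)) (τ : Equiv.Perm (Fin n)),
      (∀ i₁ i₂ : Fin m, i₁ ≤ i₂ →
        LexLe (fun j => A (σ i₂) (τ j)) (fun j => A (σ i₁) (τ j))) ∧
      (∀ j₁ j₂ : Fin n, j₁ ≤ j₂ →
        LexLe (fun i => A (σ i) (τ j₂)) (fun i => A (σ i) (τ j₁))) := by
  obtain ⟨⟨σ, τ⟩, hmax⟩ := Finite.exists_max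
    fun p : Equiv.Perm (Fin m) × Equiv.Perm (Fin n) => weightedSum fun i j => A (p.1 i) (p.2 j)
  refine ⟨σ, τ, fun i₁ i₂ hi => ?_, fun j₁ j₂ hj => ?_⟩
  · exact lexLe_rows_of_weightedSum_max (A := fun i j => A (σ i) (τ j))
      (fun π => hmax (π.trans σ, τ)) hi
  · refine lexLe_rows_of_weightedSum_max (A := fun j i => A (σ i) (τ j)) (fun π => ?_) hj
    have h := hmax (σ, π.trans τ)
    rw [← weightedSum_transpose, ← weightedSum_transpose fun i j => A (σ i) (τ j)] at h
    exact h
end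

section
/- T_{3,3}(5) = 5: there exists a multiset of 5 four-element subsets of a 5-element set such that every 3-element subset is contained in at most 2 of them (with multiplicity), and no such multiset of size 6 exists. -/
/-- Double counting of the incidences between `a`-element subsets and members of `C`. -/
theorem sum_card_filter_subset {a m : ℕ} (C : Multiset (Finset (Fin m)))
    (hC : ∀ s ∈ C, s.card = a + 1) :
    ∑ t ∈ (Finset.univ : Finset (Fin m)).powersetCard a, (C.filter fun s => t ⊆ s).card =
      (a + 1) * C.card := by
  induction C using Multiset.induction_on with
  | empty => simp
  | cons s C ih =>
    have hs : ((Finset.univ : Finset (Fin m)).powersetCard a).filter (fun t => t ⊆ s) =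
        s.powersetCard a := by
      ext t
      simp [Finset.mem_powersetCard, and_comm]
    have hcount : ∑ t ∈ (Finset.univ : Finset (Fin m)).powersetCard a,
        (if t ⊆ s then 1 else 0) = a + 1 := by
      rw [← Finset.card_filter, hs, Finset.card_powersetCard,
        hC s (Multiset.mem_cons_self s C), Nat.choose_succ_self_right]
    have hcons : ∀ t : Finset (Fin m), ((s ::ₘ C).filter fun s => t ⊆ s).card =
        (if t ⊆ s then 1 else 0) + (C.filter fun s => t ⊆ s).card := by
      intro t
      split_ifs with h <;> simp [h, add_comm]
    simp only [hcons, Finset.sum_add_distrib, hcount,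
      ih fun u hu => hC u (Multiset.mem_cons_of_mem hu), Multiset.card_cons]
    ring

theorem IsTCollection.mul_card_le {a b m : ℕ} {C : Multiset (Finset (Fin m))}
    (hC : IsTCollection a b m C) : (a + 1) * C.card ≤ m.choose a * (b - 1) := by
  rw [← sum_card_filter_subset C hC.1]
  refine (Finset.sum_le_card_nsmul _ _ (b - 1) fun t ht =>
    hC.2 t (Finset.mem_powersetCard.1 ht).2).trans_eq ?_
  simp

/-- `T_{3,3}(5) = 5`. -/
theorem stmt8 :
    (∃ C : Multiset (Finset (Fin 5)), IsTCollection 3 3 5 C ∧ Multiset.card C = 5) ∧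
      ¬ ∃ C : Multiset (Finset (Fin 5)), IsTCollection 3 3 5 C ∧
          Multiset.card C = 5 + 1 := by
  refine ⟨⟨((Finset.univ : Finset (Fin 5)).powersetCard 4).val, ⟨?_, ?_⟩, ?_⟩, ?_⟩
  · exact fun s hs => (Finset.mem_powersetCard.1 (Finset.mem_val ▸ hs)).2
  · decide
  · decide
  · rintro ⟨C, hC, hcard⟩
    have h := hC.mul_card_le
    rw [hcard] at h
    exact absurd h (by decide)
end

section
/- T_{3,3}(6) = 9: there exists a multiset of 9 four-element subsets of a 6-element set such that every 3-element subset is contained in at most 2 of them (with multiplicity), and no such multiset of size 10 exists. -/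
theorem Multiset.sum_card_filter_eq_sum_map_card_filter_s9 {α β : Type*} (r : α → β → Prop)
    [∀ a b, Decidable (r a b)] (T : Finset α) (C : Multiset β) :
    ∑ t ∈ T, (C.filter fun s => r t s).card =
      (C.map fun s => (T.filter fun t => r t s).card).sum := by
  induction C using Multiset.induction_on with
  | empty => simp
  | cons s C ih =>
    rw [Multiset.map_cons, Multiset.sum_cons, ← ih, Finset.card_filter,
      ← Finset.sum_add_distrib]
    simp only [← Multiset.countP_eq_card_filter, Multiset.countP_cons, Nat.add_comm]

/-- Each point lies in at most `6` members of a collection for `T_{3,3}(6)`: the `10` triples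
through the point are covered at most twice each, and each member through it covers three. -/
theorem IsTCollection.card_filter_mem_le_s9 {C : Multiset (Finset (Fin 6))}
    (hC : IsTCollection 3 3 6 C) (v : Fin 6) : (C.filter fun s => v ∈ s).card ≤ 6 := by
  set T : Finset (Finset (Fin 6)) := {t | t.card = 3 ∧ v ∈ t}
  have hcard : T.card = 10 := by revert v; decide
  have hcover : ∀ s : Finset (Fin 6), s.card = 4 → v ∈ s →
      (T.filter fun t => t ⊆ s).card = 3 := by
    revert v; decide +kernel
  have hle : ∑ t ∈ T, ((C.filter fun s => v ∈ s).filter fun s => t ⊆ s).card ≤ T.card • 2 := by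
    refine Finset.sum_le_card_nsmul _ _ _ fun t ht => ?_
    refine le_trans (Multiset.card_le_card ?_) (hC.2 t (Finset.mem_filter.1 ht).2.1)
    exact Multiset.filter_le_filter _ (Multiset.filter_le _ _)
  rw [Multiset.sum_card_filter_eq_sum_map_card_filter_s9 fun t s : Finset (Fin 6) => t ⊆ s,
    Multiset.map_congr rfl (g := fun _ => 3) fun s hs => hcover s
      (hC.1 s (Multiset.mem_filter.1 hs).1) (Multiset.mem_filter.1 hs).2,
    Multiset.map_const', Multiset.sum_replicate, hcard] at hle
  simp only [smul_eq_mul] at hle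
  omega

theorem IsTCollection.card_le_nine {C : Multiset (Finset (Fin 6))}
    (hC : IsTCollection 3 3 6 C) : C.card ≤ 9 := by
  have hle : ∑ v : Fin 6, (C.filter fun s => v ∈ s).card ≤ Finset.card Finset.univ • 6 :=
    Finset.sum_le_card_nsmul _ _ _ fun v _ => hC.card_filter_mem_le_s9 v
  rw [Multiset.sum_card_filter_eq_sum_map_card_filter_s9 (fun v s => v ∈ s),
    Multiset.map_congr rfl (g := fun _ => 4) fun s hs => by simpa using hC.1 s hs,
    Multiset.map_const', Multiset.sum_replicate] at hle
  simp only [smul_eq_mul, Finset.card_univ, Fintype.card_fin] at hle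
  omega

/-- `T_{3,3}(6) = 9`. -/
theorem stmt9 :
    (∃ C : Multiset (Finset (Fin 6)), IsTCollection 3 3 6 C ∧ Multiset.card C = 9) ∧
      ¬ ∃ C : Multiset (Finset (Fin 6)), IsTCollection 3 3 6 C ∧
          Multiset.card C = 9 + 1 := by
  constructor
  · refine ⟨(Finset.univ.filter fun s : Finset (Fin 6) =>
      s.card = 4 ∧ (s ∩ {0, 1, 2}).card = 2).val, ⟨?_, ?_⟩, ?_⟩ <;> decide +kernel
  · rintro ⟨C, hC, hcard⟩
    have := hC.card_le_nine
    omega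
end

section
/- T_{3,3}(12) = 108: there exists a multiset of 108 four-element subsets of a 12-element set such that every 3-element subset is contained in at most 2 of them (with multiplicity), and no such multiset of size 109 exists. -/
/-- The number of members of `C` (with multiplicity) containing `t`. -/
def coverDegree {m : ℕ} (C : Multiset (Finset (Fin m))) (t : Finset (Fin m)) : ℕ :=
  (C.filter fun s => t ⊆ s).card

/-- Double counting of the pairs `(x, s)` with `x ∉ t` and `insert x t ⊆ s ∈ C`. -/
theorem sum_coverDegree_insert {m k : ℕ} (C : Multiset (Finset (Fin m)))
    (hC : ∀ s ∈ C, s.card = k) (t : Finset (Fin m)) :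
    ∑ x ∈ tᶜ, coverDegree C (insert x t) = coverDegree C t * (k - t.card) := by
  unfold coverDegree
  induction C using Multiset.induction_on with
  | empty => simp
  | cons s C ih =>
    have hs : s.card = k := hC s (Multiset.mem_cons_self s C)
    simp only [← Multiset.countP_eq_card_filter, Multiset.countP_cons] at ih ⊢
    rw [Finset.sum_add_distrib, ih fun u hu => hC u (Multiset.mem_cons_of_mem hu), add_mul,
      Finset.sum_boole]
    congr 1
    by_cases hts : t ⊆ s
    · have h : {x ∈ tᶜ | insert x t ⊆ s} = s \ t := by
        ext x
        simp only [Finset.mem_filter, Finset.mem_compl, Finset.insert_subset_iff,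
          Finset.mem_sdiff]
        tauto
      simp [h, hts, Finset.card_sdiff_of_subset hts, hs]
    · simp [Finset.insert_subset_iff, hts]

/-- The Johnson-type bound relating the degrees of `t` and of its one-point extensions. -/
theorem coverDegree_mul_le {m k D : ℕ} (C : Multiset (Finset (Fin m)))
    (hC : ∀ s ∈ C, s.card = k) (t : Finset (Fin m))
    (hD : ∀ u : Finset (Fin m), u.card = t.card + 1 → coverDegree C u ≤ D) :
    coverDegree C t * (k - t.card) ≤ (m - t.card) * D := by
  rw [← sum_coverDegree_insert C hC t]
  refine (Finset.sum_le_card_nsmul _ _ D fun x hx => hD _ ?_).trans_eq ?_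
  · exact Finset.card_insert_of_notMem (Finset.mem_compl.mp hx)
  · simp [Finset.card_compl]

theorem IsTCollection.card_le_108 {C : Multiset (Finset (Fin 12))}
    (h : IsTCollection 3 3 12 C) : Multiset.card C ≤ 108 := by
  obtain ⟨hcard, htriple⟩ := h
  have hpair : ∀ t : Finset (Fin 12), t.card = 2 → coverDegree C t ≤ 10 := by
    intro t ht
    have := coverDegree_mul_le (D := 2) C hcard t fun u hu => htriple u (by omega)
    rw [ht] at this
    omega
  have hpoint : ∀ t : Finset (Fin 12), t.card = 1 → coverDegree C t ≤ 36 := by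
    intro t ht
    have := coverDegree_mul_le (D := 10) C hcard t fun u hu => hpair u (by omega)
    rw [ht] at this
    omega
  have := coverDegree_mul_le (D := 36) C hcard ∅ fun u hu => hpoint u (by simpa using hu)
  simp only [coverDegree, Finset.empty_subset, Multiset.filter_true, Finset.card_empty] at this
  omega

/-- The subset of `Fin 12` whose indicator function is given by the binary digits of `n`. -/
def bitSet (n : ℕ) : Finset (Fin 12) := {x | n.testBit x}

/-- The codes under `bitSet` of the translates modulo `12` of the nine base blocks `{0, 1, 2, 3}`,
`{0, 1, 3, 10}`, `{0, 1, 4, 5}`, `{0, 1, 4, 7}`, `{0, 1, 5, 7}`, `{0, 1, 6, 8}`, `{0, 1, 6, 9}`,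
`{0, 2, 4, 6}`, `{0, 2, 5, 9}`. These blocks cover every triple exactly twice, except the four
cosets of `{0, 4, 8}`, which are not covered. -/
def cyclicCodes : List ℕ :=
  [15, 1035, 51, 147, 163, 323, 579, 85, 549].flatMap fun n =>
    (List.range 12).map fun k => n <<< k ||| n >>> (12 - k)

theorem card_bitSet_of_mem_cyclicCodes : ∀ n ∈ cyclicCodes, (bitSet n).card = 4 := by
  decide +kernel

theorem countP_cyclicCodes_le : ∀ x y z : Fin 12, x < y → y < z →
    cyclicCodes.countP (fun n => n.testBit x && (n.testBit y && n.testBit z)) ≤ 2 := by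
  decide +kernel

/-- The blocks of a cyclic packing of the triples of `Fin 12`. -/
def cyclicBlocks : List (Finset (Fin 12)) := cyclicCodes.map bitSet

theorem isTCollection_cyclicBlocks : IsTCollection 3 3 12 (cyclicBlocks : Multiset _) := by
  refine ⟨List.forall_mem_map.mpr card_bitSet_of_mem_cyclicCodes, fun t ht => ?_⟩
  rw [← Multiset.countP_eq_card_filter, Multiset.coe_countP, cyclicBlocks, List.countP_map]
  have hmono := (t.orderEmbOfFin ht).strictMono
  have hsub (s : Finset (Fin 12)) : t ⊆ s ↔ t.orderEmbOfFin ht 0 ∈ s ∧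
      t.orderEmbOfFin ht 1 ∈ s ∧ t.orderEmbOfFin ht 2 ∈ s := by
    rw [← Finset.coe_subset, ← Finset.range_orderEmbOfFin t ht, Set.range_subset_iff]
    simp [Fin.forall_fin_succ]
  refine le_of_eq_of_le (List.countP_congr fun n _ => ?_) (countP_cyclicCodes_le
    (t.orderEmbOfFin ht 0) (t.orderEmbOfFin ht 1) (t.orderEmbOfFin ht 2)
    (hmono (by decide)) (hmono (by decide)))
  simp [bitSet, hsub]

/-- `T_{3,3}(12) = 108`. -/
theorem stmt10 :
    (∃ C : Multiset (Finset (Fin 12)), IsTCollection 3 3 12 C ∧ Multiset.card C = 108) ∧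
      ¬ ∃ C : Multiset (Finset (Fin 12)), IsTCollection 3 3 12 C ∧
          Multiset.card C = 108 + 1 := by
  refine ⟨⟨cyclicBlocks, isTCollection_cyclicBlocks, by decide +kernel⟩, ?_⟩
  rintro ⟨C, hC, hcard⟩
  have := hC.card_le_108
  omega
end

section
/- T_{3,3}(13) = 143: there exists a multiset of 143 four-element subsets of a 13-element set such that every 3-element subset is contained in at most 2 of them (with multiplicity), and no such multiset of size 144 exists. -/
open Finset in
/-- Counting incidences between `a`-subsets and members: a valid collection `C` satisfies
`(a + 1) * |C| ≤ (m choose a) * (b - 1)`. -/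
theorem IsTCollection.succ_mul_card_le {a b m : ℕ} {C : Multiset (Finset (Fin m))}
    (hC : IsTCollection a b m C) :
    (a + 1) * Multiset.card C ≤ m.choose a * (b - 1) := by
  have incidence : ∀ D : Multiset (Finset (Fin m)), (∀ s ∈ D, s.card = a + 1) →
      ∑ t ∈ powersetCard a univ, (D.filter fun s => t ⊆ s).card = (a + 1) * Multiset.card D := by
    intro D
    induction D using Multiset.induction_on with
    | empty => simp
    | cons s D ih =>
      intro h
      have hs : ((powersetCard a univ).filter fun t => t ⊆ s) = powersetCard a s := by
        ext t
        simp [mem_powersetCard, and_comm]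
      have hcard : (powersetCard a s).card = a + 1 := by
        rw [card_powersetCard, h s (Multiset.mem_cons_self s D), Nat.choose_succ_self_right]
      simp only [Multiset.filter_cons, Multiset.card_add, sum_add_distrib, apply_ite Multiset.card,
        Multiset.card_singleton, Multiset.card_zero, Multiset.card_cons]
      rw [ih fun u hu => h u (Multiset.mem_cons_of_mem hu), ← card_filter, hs, hcard]
      ring
  calc (a + 1) * Multiset.card C
      = ∑ t ∈ powersetCard a univ, (C.filter fun s => t ⊆ s).card := (incidence C hC.1).symm
    _ ≤ ∑ _t ∈ powersetCard a (univ : Finset (Fin m)), (b - 1) :=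
      sum_le_sum fun t ht => hC.2 t (mem_powersetCard.1 ht).2
    _ = m.choose a * (b - 1) := by simp

/-- The blocks of a cyclic `3-(13,4,2)` design, a block `s` being encoded as `∑ i ∈ s, 2 ^ i`:
all translates of eleven base blocks. Since `2 ^ 13 = 1` modulo `8191`, translation by `x` is
multiplication by `2 ^ x` modulo `8191`. -/
def cyclicDesignMasks : List ℕ :=
  (List.range 13).flatMap fun x =>
    [15, 139, 1155, 51, 83, 291, 2563, 323, 533, 293, 1093].map fun b => b * 2 ^ x % 8191

/-- The subset of `Fin m` whose elements are the positions of the nonzero bits of `b`. -/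
def bitFinset (m b : ℕ) : Finset (Fin m) :=
  Finset.univ.filter fun i => b.testBit i

/-- The blocks of the cyclic `3-(13,4,2)` design encoded by `cyclicDesignMasks`. -/
def cyclicDesign : Multiset (Finset (Fin 13)) :=
  (cyclicDesignMasks.map (bitFinset 13) : List (Finset (Fin 13)))

theorem card_of_mem_cyclicDesignMasks :
    ∀ b ∈ cyclicDesignMasks, (bitFinset 13 b).card = 4 := by
  decide +kernel

theorem countP_cyclicDesignMasks_le : ∀ i j k : Fin 13, i < j → j < k →
    cyclicDesignMasks.countP (fun b => b.testBit i && (b.testBit j && b.testBit k)) ≤ 2 := by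
  decide +kernel

theorem isTCollection_cyclicDesign : IsTCollection 3 3 13 cyclicDesign := by
  refine ⟨by simpa [cyclicDesign] using card_of_mem_cyclicDesignMasks, fun t ht => ?_⟩
  obtain ⟨i, j, k, hij, hjk, rfl⟩ :
      ∃ i j k : Fin 13, i < j ∧ j < k ∧ t = {i, j, k} := by
    have hmono := (t.orderEmbOfFin ht).strictMono
    refine ⟨_, _, _, hmono (show 0 < 1 by decide), hmono (show 1 < 2 by decide), ?_⟩
    conv_lhs => rw [← t.image_orderEmbOfFin_univ ht,
      show (Finset.univ : Finset (Fin 3)) = {0, 1, 2} from rfl, Finset.image_insert,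
      Finset.image_insert, Finset.image_singleton]
  rw [← Multiset.countP_eq_card_filter, cyclicDesign, Multiset.coe_countP, List.countP_map]
  convert countP_cyclicDesignMasks_le i j k hij hjk using 3
  simp [bitFinset, Finset.insert_subset_iff]

/-- `T_{3,3}(13) = 143`. -/
theorem stmt11 :
    (∃ C : Multiset (Finset (Fin 13)), IsTCollection 3 3 13 C ∧ Multiset.card C = 143) ∧
      ¬ ∃ C : Multiset (Finset (Fin 13)), IsTCollection 3 3 13 C ∧
          Multiset.card C = 143 + 1 := by
  refine ⟨⟨cyclicDesign, isTCollection_cyclicDesign, by simp [cyclicDesign, cyclicDesignMasks]⟩, ?_⟩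
  rintro ⟨C, hC, hcard⟩
  have hle := hC.succ_mul_card_le
  rw [hcard, show Nat.choose 13 3 = 286 by decide] at hle
  omega
end

section
/- T_{4,4}(7) = 21: there exists a multiset of 21 five-element subsets of a 7-element set such that every 4-element subset is contained in at most 3 of them (with multiplicity), and no such multiset of size 22 exists. -/
/-- Double counting of the pairs `t ⊆ s` with `t` an `a`-element set and `s ∈ C`. -/
theorem sum_card_filter_subset_s12 {α : Type*} [Fintype α] [DecidableEq α] (a : ℕ)
    (C : Multiset (Finset α)) :
    ∑ t ∈ Finset.powersetCard a Finset.univ, (C.filter fun s => t ⊆ s).card =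
      (C.map fun s => s.card.choose a).sum := by
  induction C using Multiset.induction_on with
  | empty => simp
  | cons s C ih =>
    have h : Finset.filter (· ⊆ s) (Finset.powersetCard a Finset.univ) =
        Finset.powersetCard a s := by
      ext t
      simp [Finset.mem_powersetCard, and_comm]
    simp only [← Multiset.countP_eq_card_filter] at ih
    simp only [← Multiset.countP_eq_card_filter, Multiset.countP_cons, Finset.sum_add_distrib,
      ih, Multiset.map_cons, Multiset.sum_cons, Finset.sum_boole, h, Finset.card_powersetCard,
      Nat.cast_id]
    exact add_comm _ _

theorem IsTCollection.card_mul_le {a b m : ℕ} {C : Multiset (Finset (Fin m))}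
    (hC : IsTCollection a b m C) :
    Multiset.card C * (a + 1) ≤ m.choose a * (b - 1) := by
  have h : C.map (fun s => s.card.choose a) = C.map fun _ => a + 1 :=
    Multiset.map_congr rfl fun s hs => by rw [hC.1 s hs, Nat.choose_succ_self_right]
  calc Multiset.card C * (a + 1) = (C.map fun s => s.card.choose a).sum := by simp [h]
    _ = ∑ t ∈ Finset.powersetCard a Finset.univ, (C.filter fun s => t ⊆ s).card :=
      (sum_card_filter_subset_s12 a C).symm
    _ ≤ (Finset.powersetCard a (Finset.univ : Finset (Fin m))).card * (b - 1) :=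
      Finset.sum_le_card_nsmul _ _ _ fun t ht => hC.2 t (Finset.mem_powersetCard.1 ht).2
    _ = m.choose a * (b - 1) := by simp

/-- `T_{4,4}(7) = 21`. -/
theorem stmt12 :
    (∃ C : Multiset (Finset (Fin 7)), IsTCollection 4 4 7 C ∧ Multiset.card C = 21) ∧
      ¬ ∃ C : Multiset (Finset (Fin 7)), IsTCollection 4 4 7 C ∧
          Multiset.card C = 21 + 1 := by
  constructor
  · refine ⟨(Finset.powersetCard 5 Finset.univ).val, ⟨fun s hs => ?_, ?_⟩, ?_⟩
    · exact (Finset.mem_powersetCard.1 (show s ∈ Finset.powersetCard 5 Finset.univ from hs)).2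
    · decide +kernel
    · simp [Nat.choose]
  · rintro ⟨C, hC, hcard⟩
    have h := hC.card_mul_le
    rw [hcard] at h
    simp [Nat.choose] at h
end

section
/- T_{4,4}(9) = 69: there exists a multiset of 69 five-element subsets of a 9-element set such that every 4-element subset is contained in at most 3 of them (with multiplicity), and no such multiset of size 70 exists. -/
open Finset

/-- Sum of `f` over the `k`-element supersets of `I`. -/
def upSum (k : ℕ) (f : Finset (Fin 9) → ℕ) (I : Finset (Fin 9)) : ℕ :=
  ∑ t with t.card = k ∧ I ⊆ t, f t

theorem upSum_self {k : ℕ} (f : Finset (Fin 9) → ℕ) {I : Finset (Fin 9)} (h : I.card = k) :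
    upSum k f I = f I := by
  have : (univ.filter fun t : Finset (Fin 9) => t.card = k ∧ I ⊆ t) = {I} := by
    ext t
    simp only [mem_filter, mem_univ, true_and, mem_singleton]
    constructor
    · rintro ⟨h1, h2⟩
      exact (eq_of_subset_of_card_le h2 (by omega)).symm
    · rintro rfl
      exact ⟨h, Subset.rfl⟩
  rw [upSum, this, sum_singleton]

theorem sum_upSum_insert (k : ℕ) (f : Finset (Fin 9) → ℕ) (I : Finset (Fin 9)) :
    ∑ y ∈ Iᶜ, upSum k f (insert y I) = (k - I.card) * upSum k f I := by
  simp only [upSum, sum_filter]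
  rw [sum_comm, mul_sum]
  refine sum_congr rfl fun t _ => ?_
  by_cases h : t.card = k ∧ I ⊆ t
  · rw [if_pos h, ← sum_filter, sum_const, smul_eq_mul]
    congr 1
    have : (Iᶜ.filter fun y => t.card = k ∧ insert y I ⊆ t) = t \ I := by
      ext y
      simp only [mem_filter, mem_compl, mem_sdiff, insert_subset_iff]
      tauto
    rw [this, card_sdiff_of_subset h.2, h.1]
  · rw [if_neg h, mul_zero]
    refine sum_eq_zero fun y _ => if_neg fun h' => h ⟨h'.1, (subset_insert _ _).trans h'.2⟩

theorem upSum_mono {k : ℕ} (f : Finset (Fin 9) → ℕ) {I J : Finset (Fin 9)} (h : I ⊆ J) :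
    upSum k f J ≤ upSum k f I :=
  sum_le_sum_of_subset fun t ht => by
    simp only [mem_filter, mem_univ, true_and] at ht ⊢
    exact ⟨ht.1, h.trans ht.2⟩

/-- Multiplicity functions of collections of 70 five-element sets covering each four-element set
at most three times. -/
structure Valid (c : Finset (Fin 9) → ℕ) : Prop where
  cov : ∀ t, t.card = 4 → upSum 5 c t ≤ 3
  tot : upSum 5 c ∅ = 70

/-- The largest possible degree of an `n`-element set. -/
def degBound : ℕ → ℕ
  | 0 => 70
  | 1 => 42
  | 2 => 21
  | 3 => 9
  | _ => 3

/-- The difference between the largest possible and the actual degree. -/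
def slack (c : Finset (Fin 9) → ℕ) (I : Finset (Fin 9)) : ℕ := degBound I.card - upSum 5 c I

theorem card_insert_of_mem_compl {I : Finset (Fin 9)} {y : Fin 9} (h : y ∈ Iᶜ) :
    (insert y I).card = I.card + 1 :=
  card_insert_of_notMem (mem_compl.1 h)

theorem Valid.deg_three {c : Finset (Fin 9) → ℕ} (hc : Valid c) {I : Finset (Fin 9)}
    (h : I.card = 3) : upSum 5 c I ≤ 9 := by
  have h1 := sum_upSum_insert 5 c I
  have h2 : ∑ y ∈ Iᶜ, upSum 5 c (insert y I) ≤ ∑ y ∈ Iᶜ, 3 :=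
    sum_le_sum fun y hy => hc.cov _ (by rw [card_insert_of_mem_compl hy, h])
  simp only [sum_const, card_compl, Fintype.card_fin, smul_eq_mul, h] at h1 h2
  omega

theorem Valid.deg_two {c : Finset (Fin 9) → ℕ} (hc : Valid c) {I : Finset (Fin 9)}
    (h : I.card = 2) : upSum 5 c I ≤ 21 := by
  have h1 := sum_upSum_insert 5 c I
  have h2 : ∑ y ∈ Iᶜ, upSum 5 c (insert y I) ≤ ∑ y ∈ Iᶜ, 9 :=
    sum_le_sum fun y hy => hc.deg_three (by rw [card_insert_of_mem_compl hy, h])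
  simp only [sum_const, card_compl, Fintype.card_fin, smul_eq_mul, h] at h1 h2
  omega

theorem Valid.deg_one {c : Finset (Fin 9) → ℕ} (hc : Valid c) {I : Finset (Fin 9)}
    (h : I.card = 1) : upSum 5 c I ≤ 42 := by
  have h1 := sum_upSum_insert 5 c I
  have h2 : ∑ y ∈ Iᶜ, upSum 5 c (insert y I) ≤ ∑ y ∈ Iᶜ, 21 :=
    sum_le_sum fun y hy => hc.deg_two (by rw [card_insert_of_mem_compl hy, h])
  simp only [sum_const, card_compl, Fintype.card_fin, smul_eq_mul, h] at h1 h2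
  omega

theorem Valid.deg_add_slack {c : Finset (Fin 9) → ℕ} (hc : Valid c) {I : Finset (Fin 9)}
    (h : I.card ≤ 4) : upSum 5 c I + slack c I = degBound I.card := by
  have : upSum 5 c I ≤ degBound I.card := by
    obtain h | h | h | h | h : I.card = 0 ∨ I.card = 1 ∨ I.card = 2 ∨ I.card = 3 ∨ I.card = 4 := by
      omega
    · rw [card_eq_zero.1 h, hc.tot, card_empty, degBound]
    · simpa [h, degBound] using hc.deg_one h
    · simpa [h, degBound] using hc.deg_two h
    · simpa [h, degBound] using hc.deg_three h
    · simpa [h, degBound] using hc.cov I h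
  rw [slack]
  omega

theorem Valid.sum_slack {c : Finset (Fin 9) → ℕ} (hc : Valid c) {I : Finset (Fin 9)}
    (h : I.card ≤ 3) :
    (5 - I.card) * upSum 5 c I + ∑ y ∈ Iᶜ, slack c (insert y I) =
      (9 - I.card) * degBound (I.card + 1) := by
  rw [← sum_upSum_insert, ← sum_add_distrib]
  rw [sum_congr rfl fun y hy => by
    rw [hc.deg_add_slack (by rw [card_insert_of_mem_compl hy]; omega), card_insert_of_mem_compl hy]]
  rw [sum_const, card_compl, Fintype.card_fin, smul_eq_mul]

/-- The numerical properties of the slack function of a valid collection. -/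
structure IsSlack (s : Finset (Fin 9) → ℕ) : Prop where
  le : ∀ I, I.card = 4 → s I ≤ 3
  sum_three : ∀ I, I.card = 3 → ∑ y ∈ Iᶜ, s (insert y I) = 2 * s I
  sum_two : ∀ I, I.card = 2 → ∑ y ∈ Iᶜ, s (insert y I) = 3 * s I
  sum_one : ∀ I, I.card = 1 → ∑ y ∈ Iᶜ, s (insert y I) = 4 * s I
  sum_zero : ∑ y, s {y} = 28

theorem Valid.isSlack {c : Finset (Fin 9) → ℕ} (hc : Valid c) : IsSlack (slack c) where
  le I h := by simp [slack, h, degBound]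
  sum_three I h := by
    have h1 := hc.sum_slack (I := I) (by omega)
    have h2 := hc.deg_add_slack (I := I) (by omega)
    simp only [h, degBound] at h1 h2
    omega
  sum_two I h := by
    have h1 := hc.sum_slack (I := I) (by omega)
    have h2 := hc.deg_add_slack (I := I) (by omega)
    simp only [h, degBound] at h1 h2
    omega
  sum_one I h := by
    have h1 := hc.sum_slack (I := I) (by omega)
    have h2 := hc.deg_add_slack (I := I) (by omega)
    simp only [h, degBound] at h1 h2
    omega
  sum_zero := by
    have h1 := hc.sum_slack (I := ∅) (by simp)
    simp only [hc.tot, card_empty, degBound, compl_empty, insert_empty_eq] at h1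
    omega

namespace IsSlack

variable {s : Finset (Fin 9) → ℕ}

theorem upSum_three (hs : IsSlack s) {I : Finset (Fin 9)} (h : I.card = 3) :
    upSum 4 s I = 2 * s I := by
  have h1 := sum_upSum_insert 4 s I
  rw [sum_congr rfl fun y hy =>
    upSum_self s (show (insert y I).card = 4 by rw [card_insert_of_mem_compl hy, h]),
    hs.sum_three I h, h] at h1
  omega

theorem upSum_two (hs : IsSlack s) {I : Finset (Fin 9)} (h : I.card = 2) :
    upSum 4 s I = 3 * s I := by
  have h1 := sum_upSum_insert 4 s I
  rw [sum_congr rfl fun y hy =>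
    hs.upSum_three (show (insert y I).card = 3 by rw [card_insert_of_mem_compl hy, h]),
    ← mul_sum, hs.sum_two I h, h] at h1
  omega

theorem upSum_one (hs : IsSlack s) {I : Finset (Fin 9)} (h : I.card = 1) :
    upSum 4 s I = 4 * s I := by
  have h1 := sum_upSum_insert 4 s I
  rw [sum_congr rfl fun y hy =>
    hs.upSum_two (show (insert y I).card = 2 by rw [card_insert_of_mem_compl hy, h]),
    ← mul_sum, hs.sum_one I h, h] at h1
  omega

theorem upSum_empty (hs : IsSlack s) : upSum 4 s ∅ = 28 := by
  have h1 := sum_upSum_insert 4 s ∅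
  simp only [compl_empty, insert_empty_eq, card_empty] at h1
  rw [sum_congr rfl fun y _ => hs.upSum_one (card_singleton y), ← mul_sum, hs.sum_zero] at h1
  omega

end IsSlack

/-- A variable of the search: its largest value, its packed coefficients, and the rows it
completes, given by their bit offsets and their packed sets of admissible values. -/
abbrev Item := ℕ × ℕ × List (ℕ × ℕ)

/-- A linear form with natural coefficients, an upper bound for it, and its set of admissible
values, given by the binary digits of a number. -/
structure Row where
  coeff : ℕ → ℕ
  cap : ℕ
  allowed : ℕ

/-- Whether the fields of `st` at the given offsets hold admissible values. -/
noncomputable def checkRows (st : ℕ) (l : List (ℕ × ℕ)) : Bool :=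
  List.rec true (fun p _ ih => Bool.rec false ih
    (Nat.beq 1 (Nat.land 1 (Nat.shiftRight p.2 (Nat.mod (Nat.shiftRight st p.1) 64))))) l

/-- `force n f = f n`, evaluating `n` first. -/
noncomputable def force (n : ℕ) (f : ℕ → Bool) : Bool :=
  Nat.rec (f 0) (fun n _ => f (Nat.succ n)) n

noncomputable def forcePairs (l : List (ℕ × ℕ)) : (List (ℕ × ℕ) → Bool) → Bool :=
  List.rec (fun k => k []) (fun p _ ih k =>
    force p.1 fun a => force p.2 fun b => ih fun l => k ((a, b) :: l)) l

noncomputable def forceItems (l : List Item) : (List Item → Bool) → Bool :=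
  List.rec (fun k => k []) (fun i _ ih k =>
    force i.1 fun a => force i.2.1 fun b => forcePairs i.2.2 fun c =>
      ih fun l => k ((a, b, c) :: l)) l

/-- Tries the values of one variable in increasing order until a row overflows. -/
noncomputable def tryValues (G δ : ℕ) (next : ℕ → Bool) (n : ℕ) : ℕ → Bool :=
  Nat.rec (motive := fun _ => ℕ → Bool) (fun _ => false) (fun _ loop st =>
    Nat.rec (motive := fun _ => Bool) (Bool.rec (loop (Nat.add st δ)) true (next st))
      (fun _ _ => false) (Nat.land st G)) n

/-- Depth-first search for an assignment of the variables satisfying all rows. -/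
noncomputable def search (G : ℕ) (l : List Item) : ℕ → Bool :=
  List.rec (fun _ => true) (fun i _ ih =>
    tryValues G i.2.1 (fun st => Bool.rec false (ih st) (checkRows st i.2.2)) (Nat.succ i.1)) l

/-- Packs a list of numbers into fields of six bits. -/
def pack (l : List ℕ) : ℕ := l.foldr (fun f a => f + 64 * a) 0

def compileItems (rows : List Row) : List (ℕ × ℕ) → List Item
  | [] => []
  | (m, d) :: l =>
    (d, pack (rows.map (·.coeff m)), rows.zipIdx.filterMap fun r =>
      if (r.1.coeff m == 0) || l.any (fun q => r.1.coeff q.1 != 0) then none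
      else some (6 * r.2, r.1.allowed <<< (31 - r.1.cap))) :: compileItems rows l

/-- Whether the rows have a common solution; an item is a key with the largest value there. -/
noncomputable def solvable (items : List (ℕ × ℕ)) (rows : List Row) : Bool :=
  forceItems (compileItems rows items) fun l => force (pack (rows.map fun _ => 32)) fun g =>
    force (pack (rows.map (31 - ·.cap))) fun s => search g l s

theorem force_eq (n : ℕ) (f : ℕ → Bool) : force n f = f n := by
  cases n <;> rfl

theorem forcePairs_eq (l : List (ℕ × ℕ)) (k : List (ℕ × ℕ) → Bool) : forcePairs l k = k l := by
  induction l generalizing k with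
  | nil => rfl
  | cons p l ih =>
    change (force p.1 fun a => force p.2 fun b => forcePairs l fun l => k ((a, b) :: l)) = _
    rw [force_eq, force_eq, ih]

theorem forceItems_eq (l : List Item) (k : List Item → Bool) : forceItems l k = k l := by
  induction l generalizing k with
  | nil => rfl
  | cons i l ih =>
    change (force i.1 fun a => force i.2.1 fun b => forcePairs i.2.2 fun c =>
      forceItems l fun l => k ((a, b, c) :: l)) = _
    rw [force_eq, force_eq, forcePairs_eq, ih]

theorem pack_cons (a : ℕ) (l : List ℕ) : pack (a :: l) = a + 64 * pack l := rfl

theorem pack_land_guard (l : List ℕ) (h : ∀ a ∈ l, a < 32) :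
    pack l &&& pack (l.map fun _ => 32) = 0 := by
  induction l with
  | nil => rfl
  | cons a l ih =>
    simp only [List.mem_cons, forall_eq_or_imp] at h
    rw [List.map_cons, pack_cons, pack_cons]
    have h1 := ih h.2
    have h2 : a &&& 32 = 0 := by
      have := h.1
      interval_cases a <;> rfl
    apply Nat.eq_of_testBit_eq
    intro i
    rw [Nat.testBit_and, Nat.zero_testBit, show (64 : ℕ) = 2 ^ 6 by rfl, add_comm a, add_comm 32,
      Nat.testBit_two_pow_mul_add _ (by omega), Nat.testBit_two_pow_mul_add _ (by omega)]
    split_ifs with hi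
    · rw [← Nat.testBit_and, h2, Nat.zero_testBit]
    · rw [← Nat.testBit_and, h1, Nat.zero_testBit]

theorem pack_shiftRight (l : List ℕ) (h : ∀ a ∈ l, a < 32) (i : ℕ) (hi : i < l.length) :
    (pack l >>> (6 * i)) % 64 = l[i] := by
  induction l generalizing i with
  | nil => simp at hi
  | cons a l ih =>
    simp only [List.mem_cons, forall_eq_or_imp] at h
    have := h.1
    rw [pack_cons]
    cases i with
    | zero => simp; omega
    | succ i =>
      simp only [List.getElem_cons_succ]
      rw [← ih h.2 i (by simpa using hi), mul_add, mul_one, add_comm (6 * i), Nat.shiftRight_add]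
      congr 2
      rw [Nat.shiftRight_eq_div_pow]
      omega

theorem pack_map_add {α : Type*} (l : List α) (f g : α → ℕ) (k : ℕ) :
    pack (l.map f) + k * pack (l.map g) = pack (l.map fun r => f r + k * g r) := by
  induction l with
  | nil => simp [pack]
  | cons a l ih =>
    simp only [List.map_cons, pack_cons, ← ih]
    ring

theorem checkRows_eq_true (st : ℕ) (l : List (ℕ × ℕ))
    (h : ∀ p ∈ l, Nat.testBit p.2 ((st >>> p.1) % 64)) : checkRows st l = true := by
  induction l with
  | nil => rfl
  | cons p l ih =>
    simp only [List.mem_cons, forall_eq_or_imp] at h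
    change (Bool.rec false (checkRows st l)
      (Nat.beq 1 (1 &&& (p.2 >>> ((st >>> p.1) % 64)))) : Bool) = true
    rw [ih h.2, show (1 &&& (p.2 >>> ((st >>> p.1) % 64))) = 1 by
      have h1 := h.1
      rw [Nat.testBit_eq_decide_div_mod_eq] at h1
      rw [Nat.one_and_eq_mod_two, Nat.shiftRight_eq_div_pow]
      simpa using h1]
    rfl

theorem tryValues_eq_true (G δ : ℕ) (next : ℕ → Bool) (n st k : ℕ) (hk : k < n)
    (hG : ∀ j ≤ k, (st + j * δ) &&& G = 0) (hn : next (st + k * δ) = true) :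
    tryValues G δ next n st = true := by
  induction n generalizing st k with
  | zero => omega
  | succ n ih =>
    change (Nat.rec (motive := fun _ => Bool)
      (Bool.rec (tryValues G δ next n (st + δ)) true (next st) : Bool)
      (fun _ _ => false) (st &&& G)) = true
    have h0 := hG 0 (Nat.zero_le _)
    rw [zero_mul, add_zero] at h0
    rw [h0]
    change (Bool.rec (tryValues G δ next n (st + δ)) true (next st) : Bool) = true
    cases k with
    | zero =>
      rw [zero_mul, add_zero] at hn
      rw [hn]
    | succ k =>
      rw [ih (st + δ) k (by omega)
        (fun j hj => by rw [← hG (j + 1) (by omega)]; congr 1; ring)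
        (by rw [← hn]; congr 1; ring)]
      cases next st <;> rfl

theorem search_compileItems (X : ℕ → ℕ) (items : List (ℕ × ℕ)) (ps : List (Row × ℕ))
    (hX : ∀ q ∈ items, X q.1 ≤ q.2) (hcap : ∀ p ∈ ps, p.1.cap ≤ 31)
    (hle : ∀ p ∈ ps, p.2 + (items.map fun q => p.1.coeff q.1 * X q.1).sum ≤ p.1.cap)
    (hbit : ∀ p ∈ ps,
      p.1.allowed.testBit (p.2 + (items.map fun q => p.1.coeff q.1 * X q.1).sum)) :
    search (pack (ps.map fun _ => 32)) (compileItems (ps.map (·.1)) items)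
      (pack (ps.map fun p => 31 - p.1.cap + p.2)) = true := by
  induction items generalizing ps with
  | nil => rfl
  | cons q items ih =>
    obtain ⟨m, d⟩ := q
    simp only [List.map_cons, List.sum_cons] at hle hbit
    have hstate (j : ℕ) : pack (ps.map fun p => 31 - p.1.cap + p.2) +
        j * pack ((ps.map (·.1)).map (·.coeff m)) =
        pack (ps.map fun p => 31 - p.1.cap + p.2 + j * p.1.coeff m) := by
      rw [List.map_map, pack_map_add]
      rfl
    have hlt : ∀ j ≤ X m, ∀ a ∈ ps.map fun p => 31 - p.1.cap + p.2 + j * p.1.coeff m, a < 32 := by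
      intro j hj a ha
      obtain ⟨p, hp, rfl⟩ := List.mem_map.1 ha
      have h1 := hle p hp
      have h2 := hcap p hp
      have h3 := Nat.mul_le_mul_right (p.1.coeff m) hj
      rw [mul_comm (X m)] at h3
      omega
    refine tryValues_eq_true _ _ _ _ _ (X m) (Nat.lt_succ_of_le (hX (m, d) (by simp)))
      (fun j hj => ?_) ?_
    · rw [hstate]
      have := pack_land_guard _ (hlt j hj)
      rwa [List.map_map] at this
    · rw [hstate]
      have hnext := ih (ps.map fun p => (p.1, p.2 + p.1.coeff m * X m))
        (fun q hq => hX q (List.mem_cons_of_mem _ hq))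
        (by
          intro p hp
          obtain ⟨p', hp', rfl⟩ := List.mem_map.1 hp
          exact hcap p' hp')
        (by
          intro p hp
          obtain ⟨p', hp', rfl⟩ := List.mem_map.1 hp
          have := hle p' hp'
          simp only
          omega)
        (by
          intro p hp
          obtain ⟨p', hp', rfl⟩ := List.mem_map.1 hp
          have := hbit p' hp'
          simpa only [add_assoc] using this)
      simp only [List.map_map, Function.comp_def] at hnext
      have hcheck : checkRows (pack (ps.map fun p => 31 - p.1.cap + p.2 + X m * p.1.coeff m))
          ((ps.map (·.1)).zipIdx.filterMap fun r =>
            if (r.1.coeff m == 0) || items.any (fun q => r.1.coeff q.1 != 0) then none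
            else some (6 * r.2, r.1.allowed <<< (31 - r.1.cap))) = true := by
        refine checkRows_eq_true _ _ fun x hx => ?_
        obtain ⟨⟨r, i⟩, hr, hx⟩ := List.mem_filterMap.1 hx
        obtain ⟨hi, hri⟩ : ∃ hi : i < ps.length, (ps[i]).1 = r := by
          have := List.mem_zipIdx_iff_getElem?.1 hr
          simp only [List.getElem?_map, Option.map_eq_some_iff] at this
          obtain ⟨p, hp, hpr⟩ := this
          obtain ⟨hi, h⟩ := List.getElem?_eq_some_iff.1 hp
          exact ⟨hi, by rw [h]; exact hpr⟩
        subst hri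
        split_ifs at hx with h
        · simp only [Option.some.injEq] at hx
          subst hx
          simp only [Bool.or_eq_true, List.any_eq_true, not_or, not_exists, not_and, bne_iff_ne,
            ne_eq, not_not] at h
          have hmem : ps[i] ∈ ps := List.getElem_mem hi
          have h0 : (items.map fun q => (ps[i]).1.coeff q.1 * X q.1).sum = 0 := by
            rw [List.sum_eq_zero]
            intro y hy
            obtain ⟨q, hq, rfl⟩ := List.mem_map.1 hy
            rw [h.2 q hq, zero_mul]
          have h1 := hbit _ hmem
          have h2 := hcap _ hmem
          rw [h0, add_zero] at h1
          rw [pack_shiftRight _ (hlt _ le_rfl) i (by simpa using hi), List.getElem_map,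
            Nat.testBit_shiftLeft]
          rw [show 31 - (ps[i]).1.cap + (ps[i]).2 + X m * (ps[i]).1.coeff m - (31 - (ps[i]).1.cap)
            = (ps[i]).2 + (ps[i]).1.coeff m * X m by rw [mul_comm (X m)]; omega, h1]
          simp only [Bool.and_true, decide_eq_true_eq]
          omega
      change (Bool.rec false (search _ (compileItems (ps.map (·.1)) items) _)
        (checkRows _ _) : Bool) = true
      rw [hcheck]
      simpa only [add_assoc, mul_comm (X m)] using hnext

theorem solvable_of_solution (X : ℕ → ℕ) (items : List (ℕ × ℕ)) (rows : List Row)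
    (hX : ∀ q ∈ items, X q.1 ≤ q.2) (hcap : ∀ r ∈ rows, r.cap ≤ 31)
    (hle : ∀ r ∈ rows, (items.map fun q => r.coeff q.1 * X q.1).sum ≤ r.cap)
    (hbit : ∀ r ∈ rows, r.allowed.testBit (items.map fun q => r.coeff q.1 * X q.1).sum) :
    solvable items rows = true := by
  rw [solvable, forceItems_eq, force_eq, force_eq]
  have := search_compileItems X items (rows.map fun r => (r, 0)) hX
    (by simpa using hcap) (by simpa using hle) (by simpa using hbit)
  simpa [Function.comp_def] using this

/-- The number of elements of the subset of `{0, …, 8}` with mask `m`. -/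
def popCount (m : ℕ) : ℕ := (List.range 9).countP (m.testBit ·)

/-- The masks of the `k`-element subsets of `{0, …, n - 1}`, in lexicographic order. -/
def masks (n k : ℕ) : List ℕ :=
  ((List.range n).sublistsLen k).reverse.map fun l => (l.map (2 ^ ·)).sum

/-- The linear form summing the values at the `k`-element supersets of `z`. -/
def upCoeff (k z m : ℕ) : ℕ := if popCount m = k ∧ z &&& m = z then 1 else 0

/-- The set of binary digits of a mask. -/
def toSet (m : ℕ) : Finset (Fin 9) := univ.filter fun i => m.testBit i

theorem mem_toSet {m : ℕ} {i : Fin 9} : i ∈ toSet m ↔ m.testBit i := by simp [toSet]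

theorem card_toSet (m : ℕ) : (toSet m).card = popCount m := by
  rw [toSet, card_filter, Fin.sum_univ_eq_sum_range fun i => if m.testBit i = true then 1 else 0]
  simp only [popCount, sum_range_succ, List.range_succ, List.countP_append, List.countP_singleton,
    sum_range_zero, List.range_zero, List.nil_append, zero_add]

theorem testBit_of_lt {m i : ℕ} (h : m < 512) (hi : 9 ≤ i) : m.testBit i = false :=
  Nat.testBit_lt_two_pow (h.trans_le (Nat.pow_le_pow_right (n := 2) (by norm_num) hi))

theorem toSet_subset_toSet {w m : ℕ} (hw : w < 512) : toSet w ⊆ toSet m ↔ w &&& m = w := by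
  constructor
  · intro h
    apply Nat.eq_of_testBit_eq
    intro i
    rw [Nat.testBit_and]
    by_cases hi : i < 9
    · have := @h ⟨i, hi⟩
      simp only [mem_toSet] at this
      cases hwi : w.testBit i
      · rfl
      · simp [this hwi]
    · rw [testBit_of_lt hw (by omega), Bool.false_and]
  · intro h i hi
    rw [mem_toSet] at hi ⊢
    rw [← h, Nat.testBit_and, Bool.and_eq_true] at hi
    exact hi.2

theorem toSet_injOn {w m : ℕ} (hw : w < 512) (hm : m < 512) (h : toSet w = toSet m) : w = m := by
  rw [← (toSet_subset_toSet hw).1 h.subset, Nat.and_comm, (toSet_subset_toSet hm).1 h.symm.subset]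

theorem mem_masks_nine {k : ℕ} (hk : k = 4 ∨ k = 5) :
    ∀ m ∈ masks 9 k, m < 512 ∧ popCount m = k := by
  obtain rfl | rfl := hk <;> decide +kernel

theorem nodup_masks_nine {k : ℕ} (hk : k = 4 ∨ k = 5) :
    (masks 9 k).Nodup ∧ (masks 9 k).length = 126 := by
  obtain rfl | rfl := hk <;> decide +kernel

theorem filter_card_eq {k : ℕ} (hk : k = 4 ∨ k = 5) :
    (univ.filter fun t : Finset (Fin 9) => t.card = k) = (masks 9 k).toFinset.image toSet := by
  symm
  apply eq_of_subset_of_card_le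
  · intro t ht
    simp only [mem_image, List.mem_toFinset] at ht
    obtain ⟨m, hm, rfl⟩ := ht
    simp [card_toSet, (mem_masks_nine hk m hm).2]
  · rw [card_image_of_injOn, List.toFinset_card_of_nodup (nodup_masks_nine hk).1,
      (nodup_masks_nine hk).2]
    · have : (univ.filter fun t : Finset (Fin 9) => t.card = k) = powersetCard k univ := by
        ext t; simp [mem_powersetCard]
      rw [this, card_powersetCard]
      obtain rfl | rfl := hk <;> decide
    · intro a ha b hb hab
      simp only [mem_coe, List.mem_toFinset] at ha hb
      exact toSet_injOn (mem_masks_nine hk a ha).1 (mem_masks_nine hk b hb).1 hab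

theorem upSum_toSet {k : ℕ} (hk : k = 4 ∨ k = 5) (f : Finset (Fin 9) → ℕ) {w : ℕ} (hw : w < 512) :
    upSum k f (toSet w) = ((masks 9 k).map fun m => upCoeff k w m * f (toSet m)).sum := by
  rw [upSum, ← filter_filter, filter_card_eq hk, sum_filter, sum_image, ← List.sum_toFinset]
  · refine sum_congr rfl fun m hm => ?_
    rw [List.mem_toFinset] at hm
    have := (mem_masks_nine hk m hm).2
    simp [toSet_subset_toSet hw, upCoeff, this]
  · exact (nodup_masks_nine hk).1
  · intro a ha b hb hab
    simp only [mem_coe, List.mem_toFinset] at ha hb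
    exact toSet_injOn (mem_masks_nine hk a ha).1 (mem_masks_nine hk b hb).1 hab

attribute [irreducible] masks popCount

theorem IsSlack.comp_map {s : Finset (Fin 9) → ℕ} (hs : IsSlack s) (σ : Equiv.Perm (Fin 9)) :
    IsSlack fun I => s (I.map σ.toEmbedding) := by
  have key (I : Finset (Fin 9)) : ∑ y ∈ Iᶜ, s ((insert y I).map σ.toEmbedding) =
      ∑ y ∈ (I.map σ.toEmbedding)ᶜ, s (insert y (I.map σ.toEmbedding)) := by
    refine sum_equiv σ (fun y => ?_) fun y _ => ?_
    · simp
    · rw [map_insert]; rfl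
  constructor
  · intro I h
    exact hs.le _ (by rw [card_map, h])
  · intro I h
    rw [key, hs.sum_three _ (by rw [card_map, h])]
  · intro I h
    rw [key, hs.sum_two _ (by rw [card_map, h])]
  · intro I h
    rw [key, hs.sum_one _ (by rw [card_map, h])]
  · have := key ∅
    simp only [compl_empty, insert_empty_eq, map_empty] at this
    rw [this, hs.sum_zero]

theorem exists_perm_extending {n : ℕ} (f : Fin n → Fin 9) (hf : f.Injective)
    (g : Fin n → Fin 9) (hg : g.Injective) :
    ∃ σ : Equiv.Perm (Fin 9), ∀ i, σ (g i) = f i := by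
  have := Equiv.Perm.isMultiplyPretransitive (Fin 9) n
  obtain ⟨σ, hσ⟩ := MulAction.exists_smul_eq (M := Equiv.Perm (Fin 9))
    (⟨g, hg⟩ : Fin n ↪ Fin 9) ⟨f, hf⟩
  exact ⟨σ, fun i => by simpa using DFunLike.congr_fun hσ i⟩

theorem upSum_insert_add_upSum_insert (f : Finset (Fin 9) → ℕ) (I : Finset (Fin 9)) (x y : Fin 9)
    (h : ∀ T, T.card = 4 → I ⊆ T → f T ≠ 0 → (x ∈ T ↔ y ∉ T)) :
    upSum 4 f (insert x I) + upSum 4 f (insert y I) = upSum 4 f I := by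
  simp only [upSum, sum_filter]
  rw [← sum_add_distrib]
  refine sum_congr rfl fun T _ => ?_
  by_cases h0 : f T = 0
  · simp [h0]
  by_cases hT : T.card = 4 ∧ I ⊆ T
  · have := h T hT.1 hT.2 h0
    by_cases hx : x ∈ T
    · simp [insert_subset_iff, hT, hx, this.1 hx]
    · simp [insert_subset_iff, hT, hx, not_not.1 (mt this.2 hx)]
  · simp only [insert_subset_iff]
    rw [if_neg (by tauto), if_neg (by tauto), if_neg hT, zero_add]

/-- The variables of the system describing a pair `{7, 8}` without slack. -/
def zeroItems : List (ℕ × ℕ) := (masks 7 4).map (·, 3) ++ (masks 7 3).map (·, 6)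

def zeroRows : List Row :=
  ⟨upCoeff 4 71, 3, 14⟩ :: ⟨upCoeff 4 0, 4, 16⟩ ::
  ((masks 7 1).map fun z => if z = 64 then ⟨upCoeff 4 z, 4, 18⟩ else ⟨upCoeff 4 z, 3, 9⟩) ++
  ((masks 7 1).map fun z => if z = 64 then ⟨fun m => upCoeff 3 z m + upCoeff 4 z m, 16, 2 ^ 16⟩
    else ⟨fun m => upCoeff 3 z m + upCoeff 4 z m, 12, 2 ^ 12⟩) ++
  ((masks 7 2).map fun z => ⟨fun m => upCoeff 3 z m + upCoeff 4 z m, 12, 4681⟩) ++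
  ((masks 7 2).map fun z => ⟨upCoeff 3 z, 12, 5461⟩) ++
  ((masks 7 3).map fun z => ⟨fun m => upCoeff 3 z m + upCoeff 4 z m, 12, 5461⟩)

theorem zeroSystem_unsolvable : solvable zeroItems zeroRows = false := by decide +kernel

theorem masks_nine_four_perm : (masks 9 4).Perm
    (masks 7 4 ++ ((masks 7 3).map (· + 128) ++ ((masks 7 3).map (· + 256) ++
      (masks 7 2).map (· + 384)))) := by
  decide +kernel

theorem popCount_masks_seven : (∀ z ∈ masks 7 1, popCount z = 1) ∧
    (∀ z ∈ masks 7 2, popCount z = 2) ∧ (∀ z ∈ masks 7 3, popCount z = 3) ∧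
    (∀ z ∈ masks 7 4, popCount z = 4) := by
  decide +kernel

theorem lt_of_mem_masks_seven : ∀ k ∈ [1, 2, 3, 4], ∀ z ∈ masks 7 k, z < 128 := by
  decide +kernel

theorem popCount_add : ∀ z < 128, popCount (z + 128) = popCount z + 1 ∧
    popCount (z + 256) = popCount z + 1 ∧ popCount (z + 384) = popCount z + 2 := by
  decide +kernel

theorem land_add_pow : ∀ z < 128, ∀ m < 128,
    z &&& (m + 128) = z &&& m ∧ z &&& (m + 256) = z &&& m ∧ z &&& (m + 384) = z &&& m ∧
    (z + 128) &&& (m + 128) = (z &&& m) + 128 ∧ (z + 128) &&& (m + 256) = z &&& m ∧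
    (z + 256) &&& (m + 128) = z &&& m ∧ (z + 256) &&& (m + 256) = (z &&& m) + 256 := by
  decide +kernel

theorem upCoeff_eq_zero {k z m : ℕ} (h : popCount m ≠ k) : upCoeff k z m = 0 :=
  if_neg fun h' => h h'.1

/-- The variables of the search in terms of the slack function. -/
def zeroValue (s : Finset (Fin 9) → ℕ) (m : ℕ) : ℕ :=
  if popCount m = 4 then s (toSet m) else s (toSet (m + 128)) + s (toSet (m + 256))

theorem sum_zeroItems (f : ℕ → ℕ) :
    (zeroItems.map fun q => f q.1).sum = ((masks 7 4).map f).sum + ((masks 7 3).map f).sum := by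
  simp [zeroItems, Function.comp_def]

theorem upSum_masks_seven (s : Finset (Fin 9) → ℕ) (w : ℕ) (hw : w < 512)
    (h0 : ∀ m ∈ masks 7 2, s (toSet (m + 384)) = 0) :
    upSum 4 s (toSet w) = ((masks 7 4).map fun m => upCoeff 4 w m * s (toSet m)).sum +
      ((masks 7 3).map fun m => upCoeff 4 w (m + 128) * s (toSet (m + 128)) +
        upCoeff 4 w (m + 256) * s (toSet (m + 256))).sum := by
  rw [upSum_toSet (.inl rfl) s hw, (masks_nine_four_perm.map _).sum_eq, List.map_append,
    List.map_append, List.map_append, List.sum_append, List.sum_append, List.sum_append,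
    List.map_map, List.map_map, List.map_map, List.sum_map_add]
  have : ((masks 7 2).map ((fun m => upCoeff 4 w m * s (toSet m)) ∘ (· + 384))).sum = 0 := by
    refine List.sum_eq_zero fun x hx => ?_
    obtain ⟨m, hm, rfl⟩ := List.mem_map.1 hx
    simp [h0 m hm]
  rw [this, add_zero]
  rfl

theorem sum_three_add_sum_four (s : Finset (Fin 9) → ℕ) (z : ℕ) (hz : z < 128)
    (h0 : ∀ m ∈ masks 7 2, s (toSet (m + 384)) = 0) :
    (zeroItems.map fun q => (upCoeff 3 z q.1 + upCoeff 4 z q.1) * zeroValue s q.1).sum =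
      upSum 4 s (toSet z) := by
  rw [upSum_masks_seven s z (by omega) h0,
    sum_zeroItems fun m => (upCoeff 3 z m + upCoeff 4 z m) * zeroValue s m]
  congr 2 <;> refine List.map_congr_left fun m hm => ?_
  · have h4 := popCount_masks_seven.2.2.2 m hm
    rw [upCoeff_eq_zero (k := 3) (by omega), zero_add, zeroValue, if_pos h4]
  · have h3 := popCount_masks_seven.2.2.1 m hm
    have hm' := lt_of_mem_masks_seven 3 (by simp) m hm
    have h5 := popCount_add m hm'
    have h6 := land_add_pow z hz m hm'
    rw [upCoeff_eq_zero (k := 4) (by omega), add_zero, zeroValue, if_neg (by omega), mul_add]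
    simp [upCoeff, h3, h5, h6]

theorem sum_three (s : Finset (Fin 9) → ℕ) (z : ℕ) (hz : z < 128)
    (h0 : ∀ m ∈ masks 7 2, s (toSet (m + 384)) = 0) :
    (zeroItems.map fun q => upCoeff 3 z q.1 * zeroValue s q.1).sum =
      upSum 4 s (toSet (z + 128)) + upSum 4 s (toSet (z + 256)) := by
  rw [upSum_masks_seven s _ (by omega) h0, upSum_masks_seven s _ (by omega) h0,
    sum_zeroItems fun m => upCoeff 3 z m * zeroValue s m]
  have key (w : ℕ) (hw : 128 ≤ w) :
      ((masks 7 4).map fun m => upCoeff 4 w m * s (toSet m)).sum = 0 := by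
    refine List.sum_eq_zero fun x hx => ?_
    obtain ⟨m, hm, rfl⟩ := List.mem_map.1 hx
    have h1 := lt_of_mem_masks_seven 4 (by simp) m hm
    have h2 : w &&& m ≤ m := Nat.and_le_right
    rw [upCoeff, if_neg (by omega), zero_mul]
  have key3 : ((masks 7 4).map fun m => upCoeff 3 z m * zeroValue s m).sum = 0 := by
    refine List.sum_eq_zero fun x hx => ?_
    obtain ⟨m, hm, rfl⟩ := List.mem_map.1 hx
    have h4 := popCount_masks_seven.2.2.2 m hm
    rw [upCoeff_eq_zero (by omega), zero_mul]
  rw [key _ (by omega), key _ (by omega), key3, zero_add, zero_add, zero_add, ← List.sum_map_add]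
  refine congrArg List.sum (List.map_congr_left fun m hm => ?_)
  have h3 := popCount_masks_seven.2.2.1 m hm
  have hm' := lt_of_mem_masks_seven 3 (by simp) m hm
  have h5 := popCount_add m hm'
  have h6 := land_add_pow z hz m hm'
  have h7 : z &&& m ≤ z := Nat.and_le_left
  have h8 : z &&& m ≠ z + 128 := by omega
  have h9 : z &&& m ≠ z + 256 := by omega
  simp [zeroValue, upCoeff, h3, h5, h6, h8, h9, mul_add]

theorem sum_four_add (s : Finset (Fin 9) → ℕ) (z : ℕ) (hz : z < 128)
    (h0 : ∀ m ∈ masks 7 2, s (toSet (m + 384)) = 0) :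
    upSum 4 s (toSet (z + 128)) + upSum 4 s (toSet (z + 256)) +
      (zeroItems.map fun q => upCoeff 4 z q.1 * zeroValue s q.1).sum = upSum 4 s (toSet z) := by
  rw [← sum_three s z hz h0, ← sum_three_add_sum_four s z hz h0, ← List.sum_map_add]
  simp only [add_mul]

theorem upCoeff_le_upCoeff_zero (k z m : ℕ) : upCoeff k z m ≤ upCoeff k 0 m := by
  rw [upCoeff, upCoeff, Nat.zero_and]
  split_ifs <;> simp_all

theorem mask_facts : popCount 0 = 0 ∧ popCount 71 = 4 ∧ popCount 128 = 1 ∧ popCount 256 = 1 ∧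
    popCount 199 = 5 ∧ popCount 327 = 5 ∧ popCount 384 = 2 := by
  decide +kernel

theorem upSum_eq_zero_of_lt {k : ℕ} (f : Finset (Fin 9) → ℕ) {I : Finset (Fin 9)} (h : k < I.card) :
    upSum k f I = 0 := by
  refine sum_eq_zero fun t ht => ?_
  simp only [mem_filter, mem_univ, true_and] at ht
  have := card_le_card ht.2
  omega

theorem toSet_zero : toSet 0 = ∅ := by
  ext; simp [mem_toSet]

theorem zero_pair_normalized {s : Finset (Fin 9) → ℕ} (hs : IsSlack s)
    (h1 : ∀ z ∈ masks 9 1, s (toSet z) = if z = 64 then 4 else 3) (h2 : s (toSet 384) = 0)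
    (h71 : s (toSet 71) ≠ 0) : False := by
  obtain ⟨p0, p71, p128, p256, p199, p327, p384⟩ := mask_facts
  have h0 : ∀ m ∈ masks 7 2, s (toSet (m + 384)) = 0 := by
    intro m hm
    have hm' := lt_of_mem_masks_seven 2 (by simp) m hm
    have h3 : upSum 4 s (toSet 384) = 0 := by
      rw [hs.upSum_two (by rw [card_toSet, p384]), h2]
    have h4 : toSet 384 ⊆ toSet (m + 384) := by
      rw [toSet_subset_toSet (by norm_num)]
      have : ∀ m < 128, 384 &&& (m + 384) = 384 := by decide +kernel
      exact this m hm'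
    have h5 := upSum_mono (k := 4) s h4
    rw [upSum_self s (by rw [card_toSet, (popCount_add m hm').2.2,
      popCount_masks_seven.2.1 m hm])] at h5
    omega
  have hA := sum_three_add_sum_four s
  have hB := sum_three s
  have hC := sum_four_add s
  have u7 : s (toSet 128) = 3 := h1 128 (by decide +kernel)
  have u8 : s (toSet 256) = 3 := h1 256 (by decide +kernel)
  have hu7 : upSum 4 s (toSet 128) = 12 := by rw [hs.upSum_one (by rw [card_toSet, p128]), u7]
  have hu8 : upSum 4 s (toSet 256) = 12 := by rw [hs.upSum_one (by rw [card_toSet, p256]), u8]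
  have hO : (zeroItems.map fun q => upCoeff 4 0 q.1 * zeroValue s q.1).sum = 4 := by
    have := hC 0 (by norm_num) h0
    rw [zero_add, zero_add, toSet_zero, hs.upSum_empty] at this
    omega
  have hOle (z : ℕ) : (zeroItems.map fun q => upCoeff 4 z q.1 * zeroValue s q.1).sum ≤ 4 := by
    refine le_trans ?_ hO.le
    refine List.sum_le_sum fun q _ => Nat.mul_le_mul_right _ ?_
    exact upCoeff_le_upCoeff_zero 4 z q.1
  have hpt : ∀ z ∈ masks 7 1, upSum 4 s (toSet z) = if z = 64 then 16 else 12 := by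
    intro z hz
    have h9 : ∀ z ∈ masks 7 1, z ∈ masks 9 1 := by decide +kernel
    rw [hs.upSum_one (by rw [card_toSet, popCount_masks_seven.1 z hz]), h1 z (h9 z hz)]
    split_ifs <;> rfl
  have hpairle : ∀ z ∈ masks 7 2, upSum 4 s (toSet z) ≤ 12 := by
    intro z hz
    obtain ⟨y, hy, hyz, hyn⟩ : ∃ y ∈ masks 7 1, y &&& z = y ∧ y ≠ 64 := by
      revert z hz; decide +kernel
    have := upSum_mono (k := 4) s ((toSet_subset_toSet (m := z) (by
      have := lt_of_mem_masks_seven 1 (by simp) y hy; omega)).2 hyz)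
    rw [hpt y hy, if_neg hyn] at this
    exact this
  have key : ∀ r ∈ zeroRows, (zeroItems.map fun q => r.coeff q.1 * zeroValue s q.1).sum ≤ r.cap ∧
      r.allowed.testBit (zeroItems.map fun q => r.coeff q.1 * zeroValue s q.1).sum := by
    simp only [zeroRows, List.forall_mem_cons, List.forall_mem_append, List.forall_mem_map,
      List.cons_append]
    have hbits : (∀ n < 4, n ≠ 0 → Nat.testBit 14 n) ∧ (∀ n ≤ 4, n % 3 = 1 → Nat.testBit 18 n) ∧
        (∀ n ≤ 4, n % 3 = 0 → n ≤ 3 ∧ Nat.testBit 9 n) ∧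
        (∀ n ≤ 12, n % 3 = 0 → Nat.testBit 4681 n) ∧
        (∀ n ≤ 12, n % 2 = 0 → Nat.testBit 5461 n) := by decide
    obtain ⟨b1, b2, b3, b4, b5⟩ := hbits
    refine ⟨?_, ?_, ⟨⟨⟨fun z hz => ?_, fun z hz => ?_⟩, fun z hz => ?_⟩, fun z hz => ?_⟩,
      fun z hz => ?_⟩
    · have h3 := hC 71 (by norm_num) h0
      rw [upSum_eq_zero_of_lt s (show 4 < (toSet (71 + 128)).card by rw [card_toSet, p199]; decide),
        upSum_eq_zero_of_lt s (show 4 < (toSet (71 + 256)).card by rw [card_toSet, p327]; decide),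
        zero_add, zero_add, upSum_self s (by rw [card_toSet, p71])] at h3
      have h4 := hs.le (toSet 71) (by rw [card_toSet, p71])
      rw [h3]
      exact ⟨h4, b1 _ (by omega) h71⟩
    · rw [hO]
      decide
    · have hz' := lt_of_mem_masks_seven 1 (by simp) z hz
      have h3 := hC z hz' h0
      have h5 := popCount_add z hz'
      have h6 := popCount_masks_seven.1 z hz
      rw [hpt z hz, hs.upSum_two (by rw [card_toSet]; omega),
        hs.upSum_two (by rw [card_toSet]; omega)] at h3
      by_cases h : z = 64
      · simp only [h, if_true] at h3 ⊢
        exact ⟨hOle _, b2 _ (hOle _) (by omega)⟩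
      · simp only [h, if_false] at h3 ⊢
        exact b3 _ (hOle _) (by omega)
    · have h3 := hA z (lt_of_mem_masks_seven 1 (by simp) z hz) h0
      rw [hpt z hz] at h3
      by_cases h : z = 64
      · simp only [h, if_true] at h3 ⊢
        rw [h3]
        decide
      · simp only [h, if_false] at h3 ⊢
        rw [h3]
        decide
    · rw [hA z (lt_of_mem_masks_seven 2 (by simp) z hz) h0]
      refine ⟨hpairle z hz, b4 _ (hpairle z hz) ?_⟩
      rw [hs.upSum_two (by rw [card_toSet, popCount_masks_seven.2.1 z hz])]
      omega
    · have hz' := lt_of_mem_masks_seven 2 (by simp) z hz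
      have h3 := hA z hz' h0
      have h4 := hC z hz' h0
      have h5 := popCount_add z hz'
      have h6 := popCount_masks_seven.2.1 z hz
      have h7 := hpairle z hz
      rw [hB z hz' h0]
      rw [hs.upSum_three (by rw [card_toSet]; omega),
        hs.upSum_three (by rw [card_toSet]; omega)] at h4 ⊢
      exact ⟨by omega, b5 _ (by omega) (by omega)⟩
    · have h6 := popCount_masks_seven.2.2.1 z hz
      rw [hA z (lt_of_mem_masks_seven 3 (by simp) z hz) h0]
      obtain ⟨y, hy, hyz⟩ : ∃ y ∈ masks 7 2, y &&& z = y := by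
        revert z hz; decide +kernel
      have h7 := hpairle y hy
      have h8 := upSum_mono (k := 4) s ((toSet_subset_toSet (m := z) (by
        have := lt_of_mem_masks_seven 2 (by simp) y hy; omega)).2 hyz)
      rw [hs.upSum_three (by rw [card_toSet, h6])] at h8 ⊢
      exact ⟨by omega, b5 _ (by omega) (by omega)⟩
  have hsol : solvable zeroItems zeroRows = true := by
    refine solvable_of_solution (zeroValue s) _ _ ?_ ?_ ?_ ?_
    · intro q hq
      simp only [zeroItems, List.mem_append, List.mem_map] at hq
      obtain ⟨m, hm, rfl⟩ | ⟨m, hm, rfl⟩ := hq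
      · have h4 := popCount_masks_seven.2.2.2 m hm
        simpa [zeroValue, h4] using hs.le _ (by rw [card_toSet, h4])
      · have h3 := popCount_masks_seven.2.2.1 m hm
        have hm' := lt_of_mem_masks_seven 3 (by simp) m hm
        have h5 := popCount_add m hm'
        have h6 := hs.le (toSet (m + 128)) (by rw [card_toSet]; omega)
        have h7 := hs.le (toSet (m + 256)) (by rw [card_toSet]; omega)
        change zeroValue s m ≤ 6
        rw [zeroValue, if_neg (by omega)]
        omega
    · decide +kernel
    · exact fun r hr => (key r hr).1
    · exact fun r hr => (key r hr).2
  rw [zeroSystem_unsolvable] at hsol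
  exact Bool.false_ne_true hsol

theorem exists_toSet_eq_singleton :
    ∀ z ∈ masks 9 1, ∃ i, toSet z = {i} ∧ (z = 64 ↔ i = 6) := by
  decide +kernel

theorem toSet_facts : toSet 384 = {8, 7} ∧ toSet 71 = {6, 0, 1, 2} ∧ toSet 256 = {8} := by
  decide +kernel

theorem IsSlack.eq_zero_of_subset {s : Finset (Fin 9) → ℕ} (hs : IsSlack s) {I T : Finset (Fin 9)}
    (hI : I.card = 1 ∨ I.card = 2) (h : s I = 0) (hT : T.card = 4) (hIT : I ⊆ T) : s T = 0 := by
  have h1 := upSum_mono (k := 4) s hIT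
  have h2 : upSum 4 s I = 0 := by
    obtain hI | hI := hI
    · rw [hs.upSum_one hI, h]
    · rw [hs.upSum_two hI, h]
  rw [upSum_self s hT] at h1
  omega

theorem IsSlack.pair_ne_zero {s : Finset (Fin 9) → ℕ} (hs : IsSlack s) {x y t : Fin 9}
    (hxy : x ≠ y) (hxt : x ≠ t) (hyt : y ≠ t) (ht : s {t} = 4) (h3 : ∀ z ≠ t, s {z} = 3) :
    s {x, y} ≠ 0 := by
  intro h0
  have hz (T : Finset (Fin 9)) (hT : T.card = 4) (hx : x ∈ T) (hy : y ∈ T) : s T = 0 :=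
    hs.eq_zero_of_subset (I := {x, y}) (.inr (card_pair hxy)) h0 hT
      (by simp [insert_subset_iff, hx, hy])
  obtain ⟨T, hT, htT, hsT, hxT, hyT⟩ : ∃ T : Finset (Fin 9),
      T.card = 4 ∧ t ∈ T ∧ s T ≠ 0 ∧ x ∉ T ∧ y ∉ T := by
    by_contra! hcon
    have := upSum_insert_add_upSum_insert s {t} x y fun T hT htT hsT =>
      ⟨fun hx hy => hsT (hz T hT hx hy), fun hy => by_contra fun hx =>
        hy (hcon T hT (by simpa using htT) hsT hx)⟩
    rw [hs.upSum_two (card_pair hxt), hs.upSum_two (card_pair hyt),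
      hs.upSum_one (card_singleton t), ht] at this
    omega
  obtain ⟨a, b, c, hab, hac, hbc, habc⟩ := card_eq_three.1
    (show (T.erase t).card = 3 by rw [card_erase_of_mem htT, hT])
  have hT' : T = {t, a, b, c} := by rw [← habc, insert_erase htT]
  have htn : t ∉ ({a, b, c} : Finset (Fin 9)) := by rw [← habc]; simp
  subst hT'
  simp only [mem_insert, mem_singleton, not_or] at htn hxT hyT
  have hinj : Function.Injective ![x, y, t, a, b, c] := by
    rw [← List.nodup_ofFn]
    simp
    grind
  obtain ⟨σ, hσ⟩ := exists_perm_extending _ hinj ![8, 7, 6, 0, 1, 2] (by decide)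
  have s0 : σ 8 = x := hσ 0
  have s1 : σ 7 = y := hσ 1
  have s2 : σ 6 = t := hσ 2
  have s3 : σ 0 = a := hσ 3
  have s4 : σ 1 = b := hσ 4
  have s5 : σ 2 = c := hσ 5
  refine zero_pair_normalized (hs.comp_map σ) ?_ ?_ ?_
  · intro z hz
    obtain ⟨i, hi, hi'⟩ := exists_toSet_eq_singleton z hz
    simp only [hi, map_singleton, Equiv.coe_toEmbedding]
    split_ifs with h
    · rw [hi'.1 h, s2, ht]
    · exact h3 _ fun h' => h (hi'.2 (σ.injective (h'.trans s2.symm)))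
  · simp [toSet_facts.1, map_insert, s0, s1, h0]
  · simpa [toSet_facts.2.1, map_insert, s2, s3, s4, s5] using hsT

theorem upSum_indicator (k : ℕ) (I B : Finset (Fin 9)) (hB : B.card = k) :
    upSum k (fun B' => if B' = B then 1 else 0) I = if I ⊆ B then 1 else 0 := by
  rw [upSum, sum_ite_eq']
  simp [hB]

theorem upSum_exchange {c : Finset (Fin 9) → ℕ} {A B : Finset (Fin 9)} (hA : A.card = 5)
    (hB : B.card = 5) (hcB : c B ≠ 0) (I : Finset (Fin 9)) :
    upSum 5 (fun B' => c B' + (if B' = A then 1 else 0) - if B' = B then 1 else 0) I +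
      (if I ⊆ B then 1 else 0) = upSum 5 c I + if I ⊆ A then 1 else 0 := by
  rw [← upSum_indicator 5 I B hB, ← upSum_indicator 5 I A hA, upSum, upSum, upSum, upSum,
    ← sum_add_distrib, ← sum_add_distrib]
  refine sum_congr rfl fun B' _ => ?_
  by_cases h : B' = B
  · subst h
    simp only [if_true]
    omega
  · simp [h]

theorem Valid.exists_exchange {c : Finset (Fin 9) → ℕ} (hc : Valid c) {x : Fin 9}
    {Q : Finset (Fin 9)} (hx : x ∉ Q) (hQ : Q.card = 4)
    (h : ∀ T ⊆ Q, T.card = 3 → slack c (insert x T) ≠ 0) :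
    ∃ c', Valid c' ∧ slack c' {x} < slack c {x} := by
  have hA : (insert x Q).card = 5 := by rw [card_insert_of_notMem hx, hQ]
  have hcov (T : Finset (Fin 9)) (hT : T ⊆ Q) (hT3 : T.card = 3) : upSum 5 c (insert x T) ≤ 2 := by
    have h1 : (insert x T).card = 4 := by rw [card_insert_of_notMem fun h => hx (hT h), hT3]
    have h2 := hc.deg_add_slack h1.le
    have h3 := h T hT hT3
    simp only [h1, degBound] at h2
    omega
  obtain ⟨B, hB, hcB, hxB, hQB⟩ : ∃ B : Finset (Fin 9), B.card = 5 ∧ c B ≠ 0 ∧ x ∉ B ∧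
      (Q ⊆ B ∨ upSum 5 c Q ≤ 2) := by
    by_cases hex : ∃ B : Finset (Fin 9), B.card = 5 ∧ c B ≠ 0 ∧ x ∉ B ∧ Q ⊆ B
    · obtain ⟨B, h1, h2, h3, h4⟩ := hex
      exact ⟨B, h1, h2, h3, .inl h4⟩
    · push Not at hex
      obtain ⟨T, hT, hT3⟩ := exists_subset_card_eq (show 3 ≤ Q.card by omega)
      have hle : upSum 5 c Q ≤ upSum 5 c (insert x T) := by
        rw [upSum, upSum, sum_filter, sum_filter]
        refine sum_le_sum fun B _ => ?_
        by_cases hB : B.card = 5 ∧ Q ⊆ B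
        · by_cases hcB : c B = 0
          · simp [hcB]
          · have hxB : x ∈ B := by_contra fun hxB => hex B hB.1 hcB hxB hB.2
            rw [if_pos hB, if_pos ⟨hB.1, insert_subset hxB (hT.trans hB.2)⟩]
        · rw [if_neg hB]
          exact Nat.zero_le _
      have hQ2 := hle.trans (hcov T hT hT3)
      by_contra! hcon
      have hle : upSum 5 c ∅ ≤ upSum 5 c {x} := by
        rw [upSum, upSum, sum_filter, sum_filter]
        refine sum_le_sum fun B _ => ?_
        by_cases hB : B.card = 5
        · by_cases hcB : c B = 0
          · simp [hcB]
          · have hxB : x ∈ B := by_contra fun hxB => by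
              have := (hcon B hB hcB hxB).2
              omega
            simp [hxB]
        · simp [hB]
      have := hc.deg_one (card_singleton x)
      rw [hc.tot] at hle
      omega
  have key := upSum_exchange (c := c) hA hB hcB
  have hc' : Valid fun B' =>
      c B' + (if B' = insert x Q then 1 else 0) - if B' = B then 1 else 0 := by
    refine ⟨fun t ht => ?_, ?_⟩
    · have h1 := key t
      have h2 := hc.cov t ht
      by_cases htA : t ⊆ insert x Q
      · by_cases hxt : x ∈ t
        · have h3 := hcov (t.erase x) (by rwa [← subset_insert_iff])
            (by rw [card_erase_of_mem hxt, ht])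
          rw [insert_erase hxt] at h3
          split_ifs at h1 <;> omega
        · have h3 : t = Q :=
            eq_of_subset_of_card_le ((subset_insert_iff_of_notMem hxt).1 htA) (by omega)
          subst h3
          obtain h | h := hQB
          · simp only [h, htA, if_true] at h1
            omega
          · split_ifs at h1 <;> omega
      · rw [if_neg htA] at h1
        omega
    · have h1 := key ∅
      simp only [empty_subset, if_true, hc.tot] at h1
      omega
  refine ⟨_, hc', ?_⟩
  have h1 := key {x}
  simp only [singleton_subset_iff, hxB, if_false, mem_insert_self, if_true] at h1
  have h2 := hc.deg_add_slack (card_singleton x).le.step.step.step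
  have h3 := hc'.deg_add_slack (card_singleton x).le.step.step.step
  omega

/-- The value of `s` at `{x, y}` if this is a pair, and `0` otherwise. -/
def two (s : Finset (Fin 9) → ℕ) (x y : Fin 9) : ℕ :=
  if ({x, y} : Finset (Fin 9)).card = 2 then s {x, y} else 0

def three (s : Finset (Fin 9) → ℕ) (x y z : Fin 9) : ℕ :=
  if ({x, y, z} : Finset (Fin 9)).card = 3 then s {x, y, z} else 0

def four (s : Finset (Fin 9) → ℕ) (x y z t : Fin 9) : ℕ :=
  if ({x, y, z, t} : Finset (Fin 9)).card = 4 then s {x, y, z, t} else 0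

section

variable {s : Finset (Fin 9) → ℕ}

theorem two_comm (x y : Fin 9) : two s x y = two s y x := by rw [two, two, pair_comm]

theorem three_swap (x y z : Fin 9) : three s x y z = three s x z y := by
  rw [three, three, pair_comm y]

theorem three_comm (x y z : Fin 9) : three s x y z = three s y x z := by
  rw [three, three, insert_comm]

theorem four_swap (x y z t : Fin 9) : four s x y z t = four s x y t z := by
  rw [four, four, pair_comm z]

theorem four_swap_middle (x y z t : Fin 9) : four s x y z t = four s x z y t := by
  rw [four, four, insert_comm y]

theorem four_comm (x y z t : Fin 9) : four s x y z t = four s y x z t := by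
  rw [four, four, insert_comm x]

@[simp] theorem two_self (x : Fin 9) : two s x x = 0 := by simp [two]

@[simp] theorem three_self (x y : Fin 9) : three s x y y = 0 := by
  have := card_le_two (a := x) (b := y)
  simp only [three, insert_eq_of_mem (mem_singleton_self y)]
  rw [if_neg (by omega)]

@[simp] theorem four_self (x y z : Fin 9) : four s x y z z = 0 := by
  have := card_le_three (a := x) (b := y) (c := z)
  simp only [four, insert_eq_of_mem (mem_singleton_self z)]
  rw [if_neg (by omega)]

@[simp] theorem four_self_right (x y z : Fin 9) : four s x y z y = 0 := by
  rw [four_swap_middle, four_self]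

theorem sum_insert_ite {k n : ℕ} {I : Finset (Fin 9)} (hI : I.card ≤ k)
    (h : I.card = k → ∑ y ∈ Iᶜ, s (insert y I) = n * s I) :
    (∑ y, if (insert y I).card = k + 1 then s (insert y I) else 0) =
      n * if I.card = k then s I else 0 := by
  by_cases hk : I.card = k
  · rw [if_pos hk, ← h hk, ← sum_add_sum_compl I, sum_eq_zero, zero_add]
    · exact sum_congr rfl fun y hy => if_pos (by rw [card_insert_of_mem_compl hy, hk])
    · intro y hy
      rw [insert_eq_of_mem hy, if_neg (by omega)]
  · rw [if_neg hk, mul_zero, sum_eq_zero]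
    intro y _
    have := card_insert_le y I
    exact if_neg (by omega)

namespace IsSlack

theorem sum_four (hs : IsSlack s) (x y z : Fin 9) : ∑ t, four s x y z t = 2 * three s x y z := by
  rw [three, ← sum_insert_ite (card_le_three (a := x) (b := y) (c := z)) (hs.sum_three _)]
  refine sum_congr rfl fun t _ => ?_
  rw [four_swap, four_swap_middle, four_comm, four]

theorem sum_two_three (hs : IsSlack s) (x y : Fin 9) : ∑ z, three s x y z = 3 * two s x y := by
  rw [two, ← sum_insert_ite (card_le_two (a := x) (b := y)) (hs.sum_two _)]
  refine sum_congr rfl fun t _ => ?_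
  rw [three_swap, three_comm, three]

theorem sum_pairs (hs : IsSlack s) (x : Fin 9) : ∑ y, two s x y = 4 * s {x} := by
  have := sum_insert_ite (s := s) (I := {x}) (card_singleton x).le (hs.sum_one _)
  rw [if_pos (card_singleton x)] at this
  rw [← this]
  refine sum_congr rfl fun t _ => ?_
  rw [two_comm, two]

theorem four_le_three (hs : IsSlack s) (x y z t : Fin 9) :
    four s x y z t ≤ 2 * three s x y z := by
  rw [← hs.sum_four]
  exact single_le_sum (f := four s x y z) (fun _ _ => Nat.zero_le _) (mem_univ t)

theorem three_le_two (hs : IsSlack s) (x y z : Fin 9) : three s x y z ≤ 3 * two s x y := by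
  rw [← hs.sum_two_three]
  exact single_le_sum (f := three s x y) (fun _ _ => Nat.zero_le _) (mem_univ z)

theorem three_le_one (hs : IsSlack s) {x y : Fin 9} (h : two s x y = 1) (z : Fin 9) :
    three s x y z ≤ 1 := by
  have h1 := hs.sum_four x y z
  have h2 := hs.sum_two_three x y
  rw [← add_sum_erase _ _ (mem_univ z)] at h1 h2
  have h3 : ∑ t ∈ univ.erase z, four s x y z t ≤ ∑ t ∈ univ.erase z, 2 * three s x y t :=
    sum_le_sum fun t _ => by
      rw [four_swap]
      exact hs.four_le_three x y t z
  rw [← mul_sum] at h3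
  rw [four_self] at h1
  omega

theorem card_three_ne_zero (hs : IsSlack s) {x y : Fin 9} (h : two s x y = 1) :
    (univ.filter fun z => three s x y z ≠ 0).card = 3 := by
  rw [card_filter, ← mul_one 3, ← h, ← hs.sum_two_three]
  refine sum_congr rfl fun z _ => ?_
  have := hs.three_le_one h z
  split_ifs <;> omega

theorem four_eq_one (hs : IsSlack s) {x y : Fin 9} (h : two s x y = 1) {p q : Fin 9} (hpq : p ≠ q)
    (hp : three s x y p ≠ 0) (hq : three s x y q ≠ 0) : four s x y p q = 1 := by
  obtain ⟨r, hr⟩ : ∃ r, (((univ.filter fun z => three s x y z ≠ 0).erase p).erase q) = {r} := by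
    rw [← card_eq_one, card_erase_of_mem, card_erase_of_mem, hs.card_three_ne_zero h] <;>
      simp [hp, hq, hpq.symm]
  have hS (t : Fin 9) : three s x y t ≠ 0 ↔ t = p ∨ t = q ∨ t = r := by
    have := Finset.ext_iff.1 hr t
    simp only [mem_erase, mem_filter, mem_univ, true_and, mem_singleton] at this
    by_cases h1 : t = p
    · simp [h1, hp]
    by_cases h2 : t = q
    · simp [h2, hq]
    simpa [h1, h2] using this
  have hrr : r ≠ q ∧ r ≠ p := by
    have := Finset.ext_iff.1 hr r
    simp at this
    exact ⟨this.1, this.2.1⟩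
  have hsum (z : Fin 9) (hz : three s x y z ≠ 0) :
      four s x y z p + four s x y z q + four s x y z r = 2 := by
    have h1 := hs.sum_four x y z
    have h2 := hs.three_le_one h z
    rw [← sum_subset (subset_univ {p, q, r}), sum_insert (by simp [hpq, hrr.2.symm]),
      sum_pair hrr.1.symm] at h1
    · omega
    · intro t _ ht
      have := hs.four_le_three x y t z
      rw [four_swap]
      have : three s x y t = 0 := by
        by_contra h0
        exact ht (by simpa using (hS t).1 h0)
      omega
  have h1 := hsum p hp
  have h2 := hsum q hq
  have h3 := hsum r ((hS r).2 (by simp))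
  rw [four_self] at h1 h2 h3
  rw [four_swap x y q p] at h2
  rw [four_swap x y r p, four_swap x y r q] at h3
  omega

end IsSlack

/-- No four points have all their triples in the support of the link of `x`. -/
def LinkFree (s : Finset (Fin 9) → ℕ) (x : Fin 9) : Prop :=
  ∀ p q r t, four s x p q r ≠ 0 → four s x p q t ≠ 0 → four s x p r t ≠ 0 → four s x q r t = 0

theorem LinkFree.two_le (hx : LinkFree s x) (hs : IsSlack s) {y z : Fin 9} (h : two s x y = 1)
    (hz : three s x y z ≠ 0) : 2 ≤ two s x z := by
  by_contra! hlt
  have hzy : three s x z y ≠ 0 := by rwa [three_swap]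
  have h1 : two s x z = 1 := by
    have := hs.three_le_two x z y
    omega
  obtain ⟨b, c, hbc, hS⟩ : ∃ b c, b ≠ c ∧
      ((univ.filter fun z => three s x y z ≠ 0).erase z) = {b, c} := by
    rw [← card_eq_two, card_erase_of_mem (by simp [hz]), hs.card_three_ne_zero h]
  have key (b : Fin 9) (hb : b ∈ ((univ.filter fun z => three s x y z ≠ 0).erase z)) :
      three s x y b ≠ 0 ∧ four s x y z b = 1 ∧ three s x z b ≠ 0 := by
    simp only [mem_erase, mem_filter, mem_univ, true_and] at hb
    have h2 := hs.four_eq_one h hb.1.symm hz hb.2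
    refine ⟨hb.2, h2, ?_⟩
    have := hs.four_le_three x z b y
    rw [four_swap, four_swap_middle] at this
    omega
  have hb := key b (by simp [hS])
  have hc := key c (by simp [hS])
  have h3 := hx y z b c
  have h4 := hs.four_eq_one h hbc hb.1 hc.1
  have h5 := hs.four_eq_one h1 hbc hb.2.2 hc.2.2
  omega

end

section
variable {s : Finset (Fin 9) → ℕ}

namespace IsSlack

theorem three_eq_zero (hs : IsSlack s) {x z : Fin 9} (h : two s x z = 0) (y : Fin 9) :
    three s x y z = 0 := by
  have := hs.three_le_two x z y
  rw [three_swap]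
  omega

theorem four_eq_zero (hs : IsSlack s) {x t : Fin 9} (h : two s x t = 0) (y z : Fin 9) :
    four s x y z t = 0 := by
  have := hs.four_le_three x t y z
  have := hs.three_eq_zero h y
  rw [four_swap, four_swap_middle]
  rw [three_swap] at this
  omega

end IsSlack

theorem LinkFree.three_dvd (hx : LinkFree s x) (hs : IsSlack s)
    (h : (univ.filter fun y => two s x y ≠ 0).card ≤ 4) : 3 ∣ s {x} := by
  obtain ⟨Q, hQ, hQ4⟩ := exists_superset_card_eq h (by simp)
  obtain ⟨a, Q', ha, rfl, hQ'⟩ := card_eq_succ.1 hQ4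
  obtain ⟨b, c, d, hbc, hbd, hcd, rfl⟩ := card_eq_three.1 hQ'
  have hsum (f : Fin 9 → ℕ) (hf : ∀ t, two s x t = 0 → f t = 0) :
      ∑ t, f t = f a + (f b + (f c + f d)) := by
    rw [← sum_subset (subset_univ (insert a {b, c, d})), sum_insert ha,
      sum_insert (by simp [hbc, hbd]), sum_pair hcd]
    intro t _ ht
    apply hf
    by_contra h0
    exact ht (hQ (by simp [h0]))
  have h1 (y : Fin 9) :=
    (hsum _ fun t ht => hs.three_eq_zero ht y).symm.trans (hs.sum_two_three x y)
  have h2 (y z : Fin 9) :=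
    (hsum _ fun t ht => hs.four_eq_zero ht y z).symm.trans (hs.sum_four x y z)
  have h3 := (hsum _ fun t ht => ht).symm.trans (hs.sum_pairs x)
  have ha := h1 a
  have hb := h1 b
  have hc := h1 c
  have hd := h1 d
  have hab := h2 a b
  have hac := h2 a c
  have had := h2 a d
  have hbc := h2 b c
  have hbd := h2 b d
  have hcd := h2 c d
  have := hx a b c d
  simp only [four_self, four_self_right, three_self, three_swap x b a,
    three_swap x c a, three_swap x d a, three_swap x c b, three_swap x d b, three_swap x d c,
    four_swap x a c b, four_swap x a d b, four_swap x a d c, four_swap x b d c,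
    four_swap x b c a, four_swap x b d a, four_swap x c d a, four_swap_middle x b a,
    four_swap_middle x c a, four_swap x c d b, four_swap_middle x c b] at *
  have ea : four s x b c d + 3 * two s x a = 4 * s {x} := by linarith
  have eb : four s x a c d + 3 * two s x b = 4 * s {x} := by linarith
  have ec : four s x a b d + 3 * two s x c = 4 * s {x} := by linarith
  have ed : four s x a b c + 3 * two s x d = 4 * s {x} := by linarith
  clear * - ea eb ec ed this
  omega

theorem LinkFree.not_le_two (hx : LinkFree s x) (hs : IsSlack s) (h0 : s {x} ≠ 0) :
    ¬ s {x} ≤ 2 := by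
  intro h2
  have hsum := hs.sum_pairs x
  by_cases hN : ∃ y, two s x y = 1
  · obtain ⟨y, hy⟩ := hN
    have hcard := hs.card_three_ne_zero hy
    have hS (y : Fin 9) (hy : two s x y = 1) :
        (univ.filter fun z => three s x y z ≠ 0) ⊆ univ.filter fun z => 2 ≤ two s x z := by
      intro z hz
      simp only [mem_filter, mem_univ, true_and] at hz ⊢
      exact hx.two_le hs hy hz
    have hle : (univ.filter fun z => two s x z = 1).card +
        2 * (univ.filter fun z => 2 ≤ two s x z).card ≤ 4 * s {x} := by
      rw [card_filter, card_filter, mul_sum, ← sum_add_distrib, ← hsum]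
      refine sum_le_sum fun z _ => ?_
      split_ifs <;> omega
    have hpos : 0 < (univ.filter fun z => two s x z = 1).card := card_pos.2 ⟨y, by simp [hy]⟩
    have hR : (univ.filter fun z => 2 ≤ two s x z).card = 3 := by
      have := card_le_card (hS y hy)
      omega
    have hSeq (y : Fin 9) (hy : two s x y = 1) (z : Fin 9) :
        three s x y z ≠ 0 ↔ 2 ≤ two s x z := by
      have := Finset.ext_iff.1 (eq_of_subset_of_card_le (hS y hy)
        (by rw [hR, hs.card_three_ne_zero hy])) z
      simpa using this
    have hn : (univ.filter fun z => two s x z = 1).card ≤ 2 := by omega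
    obtain ⟨a, b, c, hab, hac, hbc, hRe⟩ := card_eq_three.1 hR
    have hmem (z : Fin 9) : 2 ≤ two s x z ↔ z = a ∨ z = b ∨ z = c := by
      simpa using Finset.ext_iff.1 hRe z
    have ha := (hmem a).2 (by simp)
    have hb := (hmem b).2 (by simp)
    have hc := (hmem c).2 (by simp)
    have hfour {y p q : Fin 9} (hy : two s x y = 1) (hpq : p ≠ q) (hp : 2 ≤ two s x p)
        (hq : 2 ≤ two s x q) : four s x y p q = 1 :=
      hs.four_eq_one hy hpq ((hSeq y hy p).2 hp) ((hSeq y hy q).2 hq)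
    have habc : four s x a b c = 0 := by
      refine hx y a b c ?_ ?_ ?_
      · rw [hfour hy hab ha hb]; simp
      · rw [hfour hy hac ha hc]; simp
      · rw [hfour hy hbc hb hc]; simp
    have hthree (p : Fin 9) (hp : p = b ∨ p = c) : three s x a p ≤ 1 := by
      have h1 : ∑ t, four s x a p t ≤ (univ.filter fun z => two s x z = 1).card := by
        rw [card_filter]
        refine sum_le_sum fun t _ => ?_
        split_ifs with ht
        · rw [four_swap, four_swap_middle, hfour ht _ ha]
          · obtain rfl | rfl := hp <;> assumption
          · obtain rfl | rfl := hp <;> assumption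
        · by_cases ht0 : two s x t = 0
          · rw [hs.four_eq_zero ht0]
          · have ht2 := (hmem t).1 (by omega)
            have := four_swap (s := s) x a c b
            obtain rfl | rfl | rfl := ht2 <;> obtain rfl | rfl := hp <;> simp [*]
      rw [hs.sum_four] at h1
      omega
    have h1 : 3 * two s x a ≤ (univ.filter fun z => two s x z = 1).card + 2 := by
      have h2 : (2 : ℕ) = ∑ t, ((if t = b then 1 else 0) + if t = c then 1 else 0) := by
        simp [sum_add_distrib]
      rw [← hs.sum_two_three, h2, card_filter, ← sum_add_distrib]
      refine sum_le_sum fun t _ => ?_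
      by_cases ht : two s x t = 1
      · have := hs.three_le_one ht a
        rw [three_swap, if_pos ht]
        omega
      · by_cases ht0 : two s x t = 0
        · simp [hs.three_eq_zero ht0]
        · obtain rfl | ht2 := (hmem t).1 (by omega)
          · simp
          · have := hthree t ht2
            obtain rfl | rfl := ht2 <;> simp <;> omega
    omega
  · push Not at hN
    have h4 : (univ.filter fun y => two s x y ≠ 0).card ≤ 4 := by
      have : 2 * (univ.filter fun y => two s x y ≠ 0).card ≤ 4 * s {x} := by
        rw [card_filter, mul_sum, ← hsum]
        refine sum_le_sum fun z _ => ?_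
        have := hN z
        split_ifs <;> omega
      omega
    have := hx.three_dvd hs h4
    omega
end

section
variable {s : Finset (Fin 9) → ℕ}

theorem two_of_ne {x y : Fin 9} (h : x ≠ y) : two s x y = s {x, y} := if_pos (card_pair h)

theorem LinkFree.regular {x : Fin 9} (hx : LinkFree s x) (hs : IsSlack s) (h3 : s {x} = 3)
    (hpos : ∀ y, y ≠ x → two s x y ≠ 0) :
    (∀ y, two s x y ≤ 2) ∧ (univ.filter fun y => two s x y = 2).card = 4 ∧
      ∀ z, two s x z = 2 → (univ.filter fun y => two s x y = 1 ∧ three s x y z ≠ 0).card = 3 := by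
  have hsum := hs.sum_pairs x
  rw [h3, show 4 * 3 = 12 from rfl] at hsum
  set N := univ.filter fun y => two s x y = 1 with hN
  set R := univ.filter fun y => 2 ≤ two s x y with hR
  have hmem {y z : Fin 9} (hy : y ∈ N) (hz : three s x y z ≠ 0) : z ∈ R := by
    simp only [hN, hR, mem_filter, mem_univ, true_and] at hy ⊢
    exact hx.two_le hs hy hz
  have hcard : N.card + R.card = 8 := by
    have : (univ.erase x).card = 8 := by simp
    rw [← this, hN, hR, card_filter, card_filter, ← sum_add_distrib, card_eq_sum_ones,
      ← add_sum_erase _ _ (mem_univ x)]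
    simp only [two_self]
    refine (zero_add _).trans (sum_congr rfl fun y hy => ?_)
    have := hpos y (ne_of_mem_erase hy)
    split_ifs <;> omega
  have hsplit : N.card + ∑ y ∈ R, two s x y = 12 := by
    rw [hN, hR, card_filter, sum_filter, ← sum_add_distrib, ← hsum]
    refine sum_congr rfl fun y _ => ?_
    split_ifs <;> omega
  have hthree (z : Fin 9) : 2 * ∑ y ∈ N, three s x y z ≤ 3 * two s x z := by
    have hNR : Disjoint N R := disjoint_filter.2 fun _ _ h1 h2 => by omega
    have h1 : ∑ y ∈ N, three s x y z + ∑ y ∈ R, three s x y z ≤ 3 * two s x z := by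
      rw [← hs.sum_two_three, ← sum_union hNR]
      simp only [three_swap x z]
      exact sum_le_sum_of_subset (subset_univ _)
    have h2 : 2 * ∑ y ∈ N, three s x y z ≤ 2 * ∑ y ∈ R, three s x y z := by
      rw [mul_sum, mul_sum]
      calc ∑ y ∈ N, 2 * three s x y z = ∑ y ∈ N, ∑ t ∈ R, four s x y z t := by
            refine sum_congr rfl fun y hy => ?_
            rw [← hs.sum_four]
            refine (sum_subset (subset_univ _) fun t _ ht => ?_).symm
            by_contra h0
            refine ht (hmem hy (z := t) fun h => h0 ?_)
            have := hs.four_le_three x y t z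
            rw [four_swap]
            omega
        _ = ∑ t ∈ R, ∑ y ∈ N, four s x t z y := by
            rw [sum_comm]
            refine sum_congr rfl fun t _ => sum_congr rfl fun y _ => ?_
            rw [four_swap, four_swap_middle, four_swap]
        _ ≤ ∑ t ∈ R, 2 * three s x t z := by
            refine sum_le_sum fun t _ => ?_
            rw [← hs.sum_four]
            exact sum_le_sum_of_subset (subset_univ _)
    omega
  have hdouble : ∑ z ∈ R, ∑ y ∈ N, three s x y z = 3 * N.card := by
    rw [sum_comm, mul_comm, card_eq_sum_ones, sum_mul]
    refine sum_congr rfl fun y hy => ?_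
    have : two s x y = 1 := by simpa [hN] using hy
    rw [one_mul, ← mul_one 3, ← this, ← hs.sum_two_three]
    refine sum_subset (subset_univ _) fun z _ hz => ?_
    by_contra h0
    exact hz (hmem hy h0)
  have h6 : 2 * (3 * N.card) ≤ 3 * ∑ y ∈ R, two s x y := by
    rw [← hdouble, mul_sum, mul_sum]
    exact sum_le_sum fun z _ => hthree z
  have h2R : ∑ y ∈ R, 2 ≤ ∑ y ∈ R, two s x y := sum_le_sum fun y hy => by simpa [hR] using hy
  have hR4 : R.card = 4 := by
    rw [sum_const, smul_eq_mul] at h2R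
    omega
  have htwo : ∀ y ∈ R, two s x y = 2 := by
    refine fun y hy => ((sum_eq_sum_iff_of_le (s := R) (f := fun _ => 2) fun y hy => ?_).1 ?_
      y hy).symm
    · simpa [hR] using hy
    · rw [sum_const, smul_eq_mul]
      omega
  refine ⟨fun y => ?_, ?_, fun z hz => ?_⟩
  · by_contra! hlt
    have := htwo y (by simp [hR]; omega)
    omega
  · rw [← hR4]
    congr 1
    ext y
    simp only [mem_filter, mem_univ, true_and, hR]
    refine ⟨fun h => h.ge, fun h => htwo y (by simpa [hR] using h)⟩
  · have hz3 : ∑ y ∈ N, three s x y z = 3 := by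
      refine (sum_eq_sum_iff_of_le (s := R) (f := fun z => ∑ y ∈ N, three s x y z)
        (g := fun _ => 3)
        fun z hz => ?_).1 ?_ z (mem_filter.2 ⟨mem_univ z, hz.ge⟩)
      · have := hthree z
        rw [htwo z hz] at this
        omega
      · rw [hdouble, sum_const, smul_eq_mul]
        omega
    rw [← hz3, hN, sum_filter, card_filter]
    refine sum_congr rfl fun y _ => ?_
    by_cases hy : two s x y = 1
    · have := hs.three_le_one hy z
      simp only [hy, true_and, if_true]
      split_ifs <;> omega
    · simp [hy]

theorem IsSlack.mem_iff_notMem (hs : IsSlack s) {x t : Fin 9} (hxt : x ≠ t) (ht : s {t} = 4)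
    (hx : s {x} = 3) (h : s {x, t} = 0) {T : Finset (Fin 9)} (hT : T.card = 4) (h0 : s T ≠ 0) :
    x ∈ T ↔ t ∉ T := by
  have hboth {T : Finset (Fin 9)} (hT : T.card = 4) (h1 : x ∈ T) (h2 : t ∈ T) : s T = 0 :=
    hs.eq_zero_of_subset (.inr (card_pair hxt)) h hT (by simp [insert_subset_iff, h1, h2])
  refine ⟨fun h1 h2 => h0 (hboth hT h1 h2), fun h1 => by_contra fun h2 => h0 ?_⟩
  have hle : upSum 4 s {x} + upSum 4 s {t} + ∑ T', (if T' = T then s T' else 0) ≤ upSum 4 s ∅ := by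
    simp only [upSum, sum_filter]
    rw [← sum_add_distrib, ← sum_add_distrib]
    refine sum_le_sum fun T' _ => ?_
    by_cases hT' : T'.card = 4
    · have := hboth hT'
      by_cases hx' : x ∈ T' <;> by_cases ht' : t ∈ T' <;> by_cases he : T' = T <;>
        simp_all
    · have : T' ≠ T := by rintro rfl; exact hT' hT
      simp [hT', this]
  rw [hs.upSum_empty, hs.upSum_one (card_singleton _), hs.upSum_one (card_singleton _), hx, ht,
    sum_ite_eq'] at hle
  simp only [mem_univ, if_true] at hle
  omega

theorem IsSlack.apex_pair_ne_zero (hs : IsSlack s) {x t : Fin 9} (hxt : x ≠ t) (ht : s {t} = 4)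
    (h3 : ∀ z ≠ t, s {z} = 3) : s {x, t} ≠ 0 := by
  intro h
  have hT (I T : Finset (Fin 9)) (hT : T.card = 4) (_ : I ⊆ T) (h0 : s T ≠ 0) :=
    hs.mem_iff_notMem hxt ht (h3 x hxt) h hT h0
  obtain ⟨z, hzx, hzt⟩ : ∃ z, z ≠ x ∧ z ≠ t := by clear * -; decide +revert
  have h1 := upSum_insert_add_upSum_insert s {z} x t (hT {z})
  rw [hs.upSum_one (card_singleton z), hs.upSum_two (card_pair hzx.symm),
    hs.upSum_two (card_pair hzt.symm), ← two_of_ne (s := s) hzx.symm, ← two_of_ne (s := s) hzt.symm,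
    h3 z hzt,
    two_comm x, two_comm t] at h1
  have heven (z' : Fin 9) (h1 : z' ≠ x) (h2 : z' ≠ t) (hz : z ≠ z') : 2 ≤ two s z z' := by
    have h4 := upSum_insert_add_upSum_insert s {z, z'} x t (hT {z, z'})
    have h5 := hs.pair_ne_zero hz hzt h2 ht h3
    rw [hs.upSum_two (card_pair hz),
      hs.upSum_three (card_eq_three.2 ⟨x, z, z', hzx.symm, h1.symm, hz, rfl⟩),
      hs.upSum_three (card_eq_three.2 ⟨t, z, z', hzt.symm, h2.symm, hz, rfl⟩),
      ← two_of_ne (s := s) hz] at h4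
    rw [← two_of_ne (s := s) hz] at h5
    omega
  have h2 := hs.sum_pairs z
  have hxm : x ∈ univ.erase z := by simp [hzx.symm]
  have htm : t ∈ (univ.erase z).erase x := by simp [hzt.symm, hxt.symm]
  rw [← add_sum_erase _ _ (mem_univ z), ← add_sum_erase _ _ hxm, ← add_sum_erase _ _ htm, h3 z hzt,
    two_self] at h2
  have h4 : ∑ z' ∈ ((univ.erase z).erase x).erase t, 2 ≤
      ∑ z' ∈ ((univ.erase z).erase x).erase t, two s z z' := by
    refine sum_le_sum fun z' hz' => ?_
    simp only [mem_erase, mem_univ, and_true] at hz'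
    exact heven z' hz'.2.1 hz'.1 (Ne.symm hz'.2.2)
  rw [sum_const, card_erase_of_mem htm, card_erase_of_mem hxm, card_erase_of_mem (mem_univ z),
    card_univ, Fintype.card_fin, smul_eq_mul] at h4
  omega

theorem IsSlack.not_three_le (hs : IsSlack s) (hfree : ∀ x, s {x} = 3 → LinkFree s x) :
    ¬ ∀ x, 3 ≤ s {x} := by
  intro hle
  have hsum := hs.sum_zero
  obtain ⟨t, ht⟩ : ∃ t, s {t} ≠ 3 := by
    by_contra! h
    simp [h] at hsum
  have hrest : ∑ x ∈ univ.erase t, 3 ≤ ∑ x ∈ univ.erase t, s {x} := sum_le_sum fun x _ => hle x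
  rw [← add_sum_erase _ _ (mem_univ t)] at hsum
  have ht3 := hle t
  have hcard : ∑ x ∈ univ.erase t, 3 = 24 := by simp
  have ht4 : s {t} = 4 := by omega
  have h3 (z : Fin 9) (hz : z ≠ t) : s {z} = 3 :=
    ((sum_eq_sum_iff_of_le (s := univ.erase t) (f := fun _ => 3) fun x _ => hle x).1
      (by omega) z (by simp [hz])).symm
  have hpos (x y : Fin 9) (hyx : y ≠ x) : two s x y ≠ 0 := by
    by_cases hx : x = t
    · rw [two_comm, two_of_ne hyx, hx]
      exact hs.apex_pair_ne_zero (hx ▸ hyx) ht4 h3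
    · rw [two_of_ne hyx.symm]
      by_cases hy : y = t
      · rw [hy]
        exact hs.apex_pair_ne_zero hx ht4 h3
      · exact hs.pair_ne_zero hyx.symm hx hy ht4 h3
  have hreg (x : Fin 9) (hx : x ≠ t) :=
    (hfree x (h3 x hx)).regular hs (h3 x hx) (hpos x)
  have htwo (x : Fin 9) (hx : x ≠ t) : two s x t = 2 := by
    rw [two_comm]
    have h1 := hs.sum_pairs t
    rw [← add_sum_erase _ _ (mem_univ t), two_self, ht4, zero_add] at h1
    refine (sum_eq_sum_iff_of_le (g := fun _ => 2) fun x hx => ?_).1 ?_ x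
      (mem_erase.2 ⟨hx, mem_univ x⟩)
    · rw [two_comm]
      exact (hreg x (ne_of_mem_erase hx)).1 t
    · rw [h1]; simp
  obtain ⟨x, hx⟩ : ∃ x, x ≠ t := exists_ne t
  obtain ⟨-, hR, hk⟩ := hreg x hx
  obtain ⟨a, ha, hat⟩ := exists_mem_ne (s := univ.filter fun y => two s x y = 2) (by omega) t
  rw [mem_filter] at ha
  have hY := hk a ha.2
  have hax : a ≠ x := by
    rintro rfl
    simp at ha
  have hRa := (hreg a hat).2.1
  have hsub : insert x (insert t (univ.filter fun y => two s x y = 1 ∧ three s x y a ≠ 0)) ⊆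
      univ.filter fun y => two s a y = 2 := by
    intro y hy
    simp only [mem_insert, mem_filter, mem_univ, true_and] at hy ⊢
    obtain rfl | rfl | hy := hy
    · rw [two_comm]; exact ha.2
    · exact htwo a hat
    · have hyt : y ≠ t := by
        rintro rfl
        have := htwo x hx
        omega
      have h1 := (hreg a hat).1 y
      have h2 := (hfree y (h3 y hyt)).two_le hs (y := x) (z := a) (by rw [two_comm, hy.1])
        (by rw [three_comm]; exact hy.2)
      rw [two_comm] at h2
      omega
  have := card_le_card hsub
  rw [card_insert_of_notMem (by simp [hx]), card_insert_of_notMem (by simp [htwo x hx]), hY, hRa]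
    at this
  omega
end

/-- The variables of the system describing a point `8` without slack: the blocks containing `7` and
`8`, followed by the slacks of the four-element sets avoiding `8`. -/
def designItems : List (ℕ × ℕ) :=
  ((masks 7 3).map fun m => (m, if m = 7 ∨ m = 11 then 0 else 1)) ++
    ((masks 7 3).map fun m => (m + 384, 3)) ++ (masks 7 4).map fun m => (m + 256, 3)

/-- The three-element set complementary to `q`, or to its complement, in `{0, …, 7}`. -/
def partnerMask (q : ℕ) : ℕ := if q < 128 then 127 - q else q - 128

def designRows : List Row :=
  ((masks 7 2).map fun z => ⟨upCoeff 3 z, 3, 2 ^ 3⟩) ++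
  ((masks 8 4).map fun q =>
    ⟨fun m => (if m = q + 256 then 1 else 0) + if m = partnerMask q then 3 else 0, 3, 15⟩) ++
  ((masks 8 3).map fun z => ⟨upCoeff 5 (z + 256), 28, 357913941⟩) ++
  ((masks 8 2).map fun z => ⟨upCoeff 5 (z + 256), 27, 153391689⟩) ++
  ((masks 7 1).map fun z => ⟨upCoeff 5 (z + 256), 28, 286331153⟩) ++
  [⟨upCoeff 5 384, 12, 4369⟩, ⟨upCoeff 5 256, 28, 2 ^ 28⟩]

theorem designSystem_unsolvable : solvable designItems designRows = false := by decide +kernel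

section

variable {c : Finset (Fin 9) → ℕ} {x : Fin 9}

theorem IsSlack.eq_zero_of_mem {s : Finset (Fin 9) → ℕ} (hs : IsSlack s) (hx : s {x} = 0)
    {I : Finset (Fin 9)} (hI : x ∈ I) (hI4 : I.card ≤ 4) : s I = 0 := by
  have h1 := upSum_mono (k := 4) s (singleton_subset_iff.2 hI)
  rw [hs.upSum_one (card_singleton x), hx] at h1
  have h0 : I.card ≠ 0 := card_ne_zero_of_mem hI
  obtain h | h | h | h : I.card = 1 ∨ I.card = 2 ∨ I.card = 3 ∨ I.card = 4 := by omega
  · have := hs.upSum_one h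
    omega
  · have := hs.upSum_two h
    omega
  · have := hs.upSum_three h
    omega
  · have := upSum_self s h
    omega

theorem Valid.upSum_of_mem (hc : Valid c) (hx : slack c {x} = 0) {I : Finset (Fin 9)}
    (hI : x ∈ I) (hI4 : I.card ≤ 4) : upSum 5 c I = degBound I.card := by
  have h1 := hc.deg_add_slack hI4
  rwa [hc.isSlack.eq_zero_of_mem hx hI hI4] at h1

/-- Sum of `c` over the five-element supersets of `I` disjoint from `J`. -/
def sumAvoiding (c : Finset (Fin 9) → ℕ) (I J : Finset (Fin 9)) : ℕ :=
  ∑ B with B.card = 5 ∧ I ⊆ B ∧ Disjoint J B, c B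

theorem sumAvoiding_insert (c : Finset (Fin 9) → ℕ) (I J : Finset (Fin 9)) (j : Fin 9) :
    sumAvoiding c I (insert j J) + sumAvoiding c (insert j I) J = sumAvoiding c I J := by
  simp only [sumAvoiding, sum_filter, ← sum_add_distrib, disjoint_insert_left, insert_subset_iff]
  refine sum_congr rfl fun B _ => ?_
  by_cases hj : j ∈ B <;> simp [hj]

theorem sumAvoiding_empty (c : Finset (Fin 9) → ℕ) (I : Finset (Fin 9)) :
    sumAvoiding c I ∅ = upSum 5 c I := by
  simp [sumAvoiding, upSum]

/-- The value of `sumAvoiding c I J` for disjoint sets with `j` and at most `4 - j` elements when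
the point `x ∈ I` has no slack. -/
def avoidDeg (i : ℕ) : ℕ → ℕ
  | 0 => degBound i
  | j + 1 => avoidDeg i j - avoidDeg (i + 1) j

theorem Valid.sumAvoiding_eq_avoidDeg (hc : Valid c) (hx : slack c {x} = 0) {I J : Finset (Fin 9)}
    (hxI : x ∈ I) (hIJ : Disjoint I J) (h : I.card + J.card ≤ 4) :
    sumAvoiding c I J = avoidDeg I.card J.card := by
  induction J using Finset.induction_on generalizing I with
  | empty =>
    rw [sumAvoiding_empty, hc.upSum_of_mem hx hxI (by simpa using h), card_empty, avoidDeg]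
  | insert j J hj ih =>
    rw [card_insert_of_notMem hj] at h ⊢
    rw [disjoint_insert_right] at hIJ
    have h1 := sumAvoiding_insert c I J j
    have hI := card_insert_of_notMem hIJ.1
    rw [ih hxI hIJ.2 (by omega), ih (mem_insert_of_mem hxI) (disjoint_insert_left.2 ⟨hj, hIJ.2⟩)
      (by omega), hI] at h1
    rw [avoidDeg]
    omega

theorem Valid.sumAvoiding_insert_add (hc : Valid c) (hx : slack c {x} = 0) {I J : Finset (Fin 9)}
    {i : ℕ} (hxI : x ∈ I) (hIJ : Disjoint I J) (hI : I.card = i) (hJ : J.card = 4 - i) (hi : i ≤ 4)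
    (j : Fin 9) :
    sumAvoiding c I (insert j J) + sumAvoiding c (insert j I) J = avoidDeg i (4 - i) := by
  rw [sumAvoiding_insert, hc.sumAvoiding_eq_avoidDeg hx hxI hIJ (by omega), hI, hJ]

theorem Valid.sumAvoiding_eq (hc : Valid c) (hx : slack c {x} = 0) {Q : Finset (Fin 9)}
    (hQ : Q.card = 4) (hxQ : x ∉ Q) : sumAvoiding c {x} Q = c (insert x Q) := by
  obtain ⟨p, Q', hp, rfl, hQ'⟩ := card_eq_succ.1 hQ
  obtain ⟨q, r, t, hqr, hqt, hrt, rfl⟩ := card_eq_three.1 hQ'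
  simp only [mem_insert, mem_singleton, not_or] at hp hxQ
  obtain ⟨hpq, hpr, hpt⟩ := hp
  obtain ⟨hxp, hxq, hxr, hxt⟩ := hxQ
  have c2 : ({p, x} : Finset (Fin 9)).card = 2 := card_pair (Ne.symm hxp)
  have c3 : ({q, p, x} : Finset (Fin 9)).card = 3 :=
    card_eq_three.2 ⟨_, _, _, Ne.symm hpq, Ne.symm hxq, Ne.symm hxp, rfl⟩
  have c4 : ({r, q, p, x} : Finset (Fin 9)).card = 4 := by
    rw [card_insert_of_notMem (by grind), c3]
  have c5 : ({t, r, q, p, x} : Finset (Fin 9)).card = 5 := by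
    rw [card_insert_of_notMem (by grind), c4]
  have h1 := hc.sumAvoiding_insert_add hx (I := {x}) (J := {q, r, t}) (i := 1) (by simp)
    (disjoint_left.2 (by grind)) (card_singleton x) hQ' (by omega) p
  have h2 := hc.sumAvoiding_insert_add hx (I := {p, x}) (J := {r, t}) (i := 2) (by simp)
    (disjoint_left.2 (by grind)) c2 (card_pair hrt) (by omega) q
  have h3 := hc.sumAvoiding_insert_add hx (I := {q, p, x}) (J := {t}) (i := 3) (by simp)
    (disjoint_left.2 (by grind)) c3 (card_singleton t) (by omega) r
  have h4 := hc.sumAvoiding_insert_add hx (I := {r, q, p, x}) (J := ∅) (i := 4) (by simp)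
    (disjoint_empty_right _) c4 card_empty le_rfl t
  rw [sumAvoiding_empty, upSum_self c c5, insert_empty_eq,
    show ({t, r, q, p, x} : Finset (Fin 9)) = {x, p, q, r, t} by grind] at h4
  have e : avoidDeg 1 (4 - 1) = 3 ∧ avoidDeg 2 (4 - 2) = 6 ∧ avoidDeg 3 (4 - 3) = 6 ∧
      avoidDeg 4 (4 - 4) = 3 := by
    decide
  omega

/-- Blocks through `x` come in complementary pairs. -/
theorem Valid.apply_compl (hc : Valid c) (hx : slack c {x} = 0) {A : Finset (Fin 9)}
    (hA : A.card = 5) (hxA : x ∈ A) : c (insert x Aᶜ) = c A := by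
  have h1 := hc.sumAvoiding_eq hx (Q := A.erase x) (by rw [card_erase_of_mem hxA, hA]) (by simp)
  rw [insert_erase hxA] at h1
  rw [← h1, sumAvoiding, ← sum_singleton c (insert x Aᶜ)]
  congr 1
  ext B
  simp only [mem_singleton, mem_filter, mem_univ, true_and, singleton_subset_iff]
  have hcard : (insert x Aᶜ).card = 5 := by
    rw [card_insert_of_notMem (by simp [hxA]), card_compl, Fintype.card_fin, hA]
  constructor
  · rintro rfl
    refine ⟨hcard, mem_insert_self _ _, disjoint_left.2 fun y hy => ?_⟩
    simp only [mem_erase] at hy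
    simp [hy.1, hy.2]
  · rintro ⟨h2, h3, h4⟩
    refine eq_of_subset_of_card_le (fun y hy => ?_) (by omega)
    have := fun h => disjoint_left.1 h4 h hy
    simp only [mem_erase] at this
    simp only [mem_insert, mem_compl]
    tauto

theorem Valid.sum_erase_subset (hc : Valid c) (hx : slack c {x} = 0) {B : Finset (Fin 9)}
    (hB : B.card = 5) (hxB : x ∉ B) :
    ∑ A with (A.card = 5 ∧ x ∈ A) ∧ A.erase x ⊆ B, c A = 3 := by
  have h1 : upSum 5 c Bᶜ = 3 := by
    rw [hc.upSum_of_mem hx (by simpa using hxB)] <;> simp [card_compl, hB, degBound]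
  have hinv (A : Finset (Fin 9)) (hA : x ∈ A) : insert x (insert x Aᶜ)ᶜ = A := by
    ext y
    by_cases hy : y = x <;> simp [hy, hA]
  have hcard (A : Finset (Fin 9)) (hA : A.card = 5) (hx : x ∈ A) : (insert x Aᶜ).card = 5 := by
    rw [card_insert_of_notMem (by simp [hx]), card_compl, Fintype.card_fin, hA]
  rw [← h1, upSum]
  refine sum_bij' (fun A _ => insert x Aᶜ) (fun A _ => insert x Aᶜ) ?_ ?_ ?_ ?_ ?_
  · simp only [mem_filter, mem_univ, true_and]
    rintro A ⟨⟨h2, h3⟩, h4⟩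
    refine ⟨hcard A h2 h3, fun y hy => ?_⟩
    have := @h4 y
    simp only [mem_erase, mem_insert, mem_compl] at this hy ⊢
    tauto
  · simp only [mem_filter, mem_univ, true_and]
    rintro A ⟨h2, h3⟩
    have hxA : x ∈ A := h3 (by simpa using hxB)
    refine ⟨⟨hcard A h2 hxA, mem_insert_self _ _⟩, fun y hy => ?_⟩
    have := @h3 y
    simp only [mem_erase, mem_insert, mem_compl] at this hy ⊢
    tauto
  · simp only [mem_filter, mem_univ, true_and]
    exact fun A hA => hinv A hA.1.2
  · simp only [mem_filter, mem_univ, true_and]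
    exact fun A hA => hinv A (hA.2 (by simpa using hxB))
  · simp only [mem_filter, mem_univ, true_and]
    exact fun A hA => (hc.apply_compl hx hA.1.1 hA.1.2).symm

theorem upSum_erase (c : Finset (Fin 9) → ℕ) {A : Finset (Fin 9)} (hA : A.card = 5) (hxA : x ∈ A) :
    upSum 5 c (A.erase x) = c A + ∑ B with (B.card = 5 ∧ x ∉ B) ∧ A.erase x ⊆ B, c B := by
  rw [← upSum_self c hA, upSum, upSum, sum_filter, sum_filter, sum_filter, ← sum_add_distrib]
  refine sum_congr rfl fun B _ => ?_
  by_cases hxB : x ∈ B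
  · have : A.erase x ⊆ B ↔ A ⊆ B := by
      rw [← insert_subset_iff.trans (and_iff_right hxB), insert_erase hxA]
    simp [hxB, this]
  · have : ¬ A ⊆ B := fun h => hxB (h hxA)
    simp [hxB, this]

/-- Blocks through `x` are simple, and their remaining four points have no slack. -/
theorem Valid.simple_of_mem (hc : Valid c) (hx : slack c {x} = 0) {A : Finset (Fin 9)}
    (hA : A.card = 5) (hxA : x ∈ A) : c A ≤ 1 ∧ c A * slack c (A.erase x) = 0 := by
  set F := univ.filter fun A : Finset (Fin 9) => A.card = 5 ∧ x ∈ A with hF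
  set G := univ.filter fun B : Finset (Fin 9) => B.card = 5 ∧ x ∉ B with hG
  have hFsum : ∑ A ∈ F, c A = 42 := by
    have := hc.upSum_of_mem hx (mem_singleton_self x) (by simp)
    simpa [upSum, degBound] using this
  have hGsum : ∑ B ∈ G, c B = 28 := by
    have h1 : ∑ A ∈ F, c A + ∑ B ∈ G, c B = upSum 5 c ∅ := by
      simp only [hF, hG, upSum, sum_filter]
      rw [← sum_add_distrib]
      refine sum_congr rfl fun B _ => ?_
      by_cases hB : x ∈ B <;> simp [hB]
    rw [hc.tot, hFsum] at h1
    omega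
  have h1 : ∑ A ∈ F, c A * upSum 5 c (A.erase x) = ∑ A ∈ F, c A * c A + 84 := by
    have : ∑ B ∈ G, c B * 3 = 84 := by rw [← sum_mul, hGsum]; norm_num
    rw [← this, ← sum_congr rfl fun B hB => congrArg (c B * ·)
      (hc.sum_erase_subset hx (mem_filter.1 hB).2.1 (mem_filter.1 hB).2.2)]
    rw [sum_congr rfl fun A hA => congrArg (c A * ·)
      (upSum_erase c (mem_filter.1 hA).2.1 (mem_filter.1 hA).2.2)]
    simp only [mul_add, sum_add_distrib, mul_sum]
    congr 1
    rw [sum_comm' (t' := G)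
      (s' := fun B => univ.filter fun A => (A.card = 5 ∧ x ∈ A) ∧ A.erase x ⊆ B)]
    · exact sum_congr rfl fun B _ => sum_congr rfl fun A _ => by rw [mul_comm]
    · intro A B
      simp only [hF, hG, mem_filter, mem_univ, true_and]
      tauto
  have h2 : ∑ A ∈ F, c A * upSum 5 c (A.erase x) + ∑ A ∈ F, c A * slack c (A.erase x) = 126 := by
    have : ∑ A ∈ F, c A * 3 = 126 := by rw [← sum_mul, hFsum]; norm_num
    rw [← this, ← sum_add_distrib]
    refine sum_congr rfl fun A hA => ?_
    have hA4 : (A.erase x).card = 4 := by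
      rw [card_erase_of_mem (mem_filter.1 hA).2.2, (mem_filter.1 hA).2.1]
    rw [← mul_add, hc.deg_add_slack hA4.le, hA4, degBound]
    all_goals simp
  have h3 : ∑ A ∈ F, (c A + c A * slack c (A.erase x) + c A * (c A - 1)) = 42 := by
    have (A : Finset (Fin 9)) : c A + c A * slack c (A.erase x) + c A * (c A - 1) =
        c A * c A + c A * slack c (A.erase x) := by
      cases c A <;> simp; ring
    rw [sum_congr rfl fun A _ => this A, sum_add_distrib]
    omega
  have h4 := (sum_eq_sum_iff_of_le (s := F) (f := c)
    (g := fun A => c A + c A * slack c (A.erase x) + c A * (c A - 1)) fun A _ => by omega).1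
    (by rw [h3, hFsum]) A (by simp [hF, hA, hxA])
  have h5 : c A * (c A - 1) = 0 := by omega
  refine ⟨?_, by omega⟩
  obtain h | h := Nat.mul_eq_zero.1 h5 <;> omega

end

theorem masks_nine_five_perm : (masks 9 5).Perm
    ((masks 7 3).map (· + 384) ++ (masks 9 5).filter (· < 384)) := by
  decide +kernel

theorem land_add_bits : ∀ z < 128, ∀ m < 128,
    (z + 384) &&& (m + 384) = (z &&& m) + 384 := by
  decide +kernel

theorem land_add_high_bit : ∀ z < 256, ∀ m < 256, (z + 256) &&& (m + 256) = (z &&& m) + 256 := by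
  decide +kernel

theorem popCount_add_high_bit : ∀ z < 256, popCount (z + 256) = popCount z + 1 := by
  decide +kernel

theorem mem_masks_eight : ∀ k ∈ [1, 2, 3, 4], ∀ z ∈ masks 8 k, z < 256 ∧ popCount z = k := by
  decide +kernel

theorem toSet_partnerMask : ∀ q ∈ masks 8 4, (toSet (q + 256)).erase 8 = toSet q ∧
    popCount (partnerMask q + 384) = 5 ∧ partnerMask q ∈ masks 7 3 ∧
    (toSet (q + 256) = toSet (partnerMask q + 384) ∨
      toSet (q + 256) = insert 8 (toSet (partnerMask q + 384))ᶜ) := by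
  decide +kernel

theorem designItems_keys : (designItems.map Prod.fst).Nodup := by
  decide +kernel

theorem eight_mem_toSet : ∀ m < 256, 8 ∈ toSet (m + 256) := by
  decide +kernel

theorem sum_ite_eq_of_nodup {l : List ℕ} (hl : l.Nodup) (X : ℕ → ℕ) (k a : ℕ) :
    (l.map fun m => (if m = k then a else 0) * X m).sum ≤ a * X k := by
  rw [← List.sum_toFinset _ hl]
  simp only [ite_mul, zero_mul]
  rw [sum_ite_eq']
  split_ifs <;> simp

/-- The variables of the search in terms of a valid collection. -/
def designValue (c : Finset (Fin 9) → ℕ) (m : ℕ) : ℕ :=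
  if m < 128 then c (toSet (m + 384)) else slack c (toSet (m - 256))

theorem sum_designItems (f : ℕ → ℕ) :
    (designItems.map fun q => f q.1).sum = ((masks 7 3).map f).sum +
      ((masks 7 3).map fun m => f (m + 384)).sum + ((masks 7 4).map fun m => f (m + 256)).sum := by
  simp [designItems, Function.comp_def, add_assoc]

section

variable {c : Finset (Fin 9) → ℕ}

theorem designItems_sum_slack (hc : Valid c) (h8 : slack c {8} = 0) {z : ℕ} (hz : z < 256) :
    (designItems.map fun q => upCoeff 5 (z + 256) q.1 * designValue c q.1).sum =
      upSum 4 (slack c) (toSet z) := by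
  have h0 {m : ℕ} (hm : m < 256) (hp : popCount m ≤ 3) : slack c (toSet (m + 256)) = 0 :=
    hc.isSlack.eq_zero_of_mem h8 (eight_mem_toSet m hm)
      (by rw [card_toSet, popCount_add_high_bit m hm]; omega)
  rw [upSum_masks_seven _ z (by omega), add_comm (List.sum _),
    sum_designItems fun m => upCoeff 5 (z + 256) m * designValue c m]
  · have key : ((masks 7 3).map fun m => upCoeff 5 (z + 256) m * designValue c m).sum = 0 := by
      refine List.sum_eq_zero fun x hx => ?_
      obtain ⟨m, hm, rfl⟩ := List.mem_map.1 hx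
      rw [upCoeff_eq_zero, zero_mul]
      rw [popCount_masks_seven.2.2.1 m hm]
      decide
    rw [key, zero_add]
    refine congrArg₂ (· + ·) (congrArg List.sum (List.map_congr_left fun m hm => ?_))
      (congrArg List.sum (List.map_congr_left fun m hm => ?_))
    · have h3 := popCount_masks_seven.2.2.1 m hm
      have hm' := lt_of_mem_masks_seven 3 (by simp) m hm
      have h5 := popCount_add m hm'
      have h6 := land_add_high_bit z hz (m + 128) (by omega)
      rw [h0 (m := m) (by omega) (by omega), mul_zero, add_zero, designValue, if_neg (by omega),
        show m + 384 - 256 = m + 128 by omega]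
      rw [add_assoc] at h6
      simp [upCoeff, h3, h5, h6]
    · have h4 := popCount_masks_seven.2.2.2 m hm
      have hm' := lt_of_mem_masks_seven 4 (by simp) m hm
      have h5 := popCount_add m hm'
      have h6 := land_add_high_bit z hz m (by omega)
      rw [designValue, if_neg (by omega), Nat.add_sub_cancel]
      simp [upCoeff, h4, h5, h6]
  · intro m hm
    have hm' := lt_of_mem_masks_seven 2 (by simp) m hm
    have h5 := popCount_add m hm'
    have h6 := popCount_masks_seven.2.1 m hm
    exact h0 (m := m + 128) (by omega) (by omega)

theorem designItems_sum_upSum {z : ℕ} (hz : z < 128) :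
    (designItems.map fun q => upCoeff 3 z q.1 * designValue c q.1).sum =
      upSum 5 c (toSet (z + 384)) := by
  rw [upSum_toSet (.inr rfl) c (by omega), (masks_nine_five_perm.map _).sum_eq, List.map_append,
    List.sum_append, List.map_map, sum_designItems fun m => upCoeff 3 z m * designValue c m]
  have h1 : (((masks 9 5).filter (· < 384)).map fun m => upCoeff 5 (z + 384) m * c (toSet m)).sum
      = 0 := by
    refine List.sum_eq_zero fun x hx => ?_
    obtain ⟨m, hm, rfl⟩ := List.mem_map.1 hx
    have h2 := List.mem_filter.1 hm
    simp only [decide_eq_true_eq] at h2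
    have h3 : (z + 384) &&& m ≤ m := Nat.and_le_right
    rw [upCoeff, if_neg (by omega), zero_mul]
  have h2 : ((masks 7 3).map fun m => upCoeff 3 z (m + 384) * designValue c (m + 384)).sum = 0 := by
    refine List.sum_eq_zero fun x hx => ?_
    obtain ⟨m, hm, rfl⟩ := List.mem_map.1 hx
    have h5 := popCount_add m (lt_of_mem_masks_seven 3 (by simp) m hm)
    have h6 := popCount_masks_seven.2.2.1 m hm
    rw [upCoeff_eq_zero (by omega), zero_mul]
  have h3 : ((masks 7 4).map fun m => upCoeff 3 z (m + 256) * designValue c (m + 256)).sum = 0 := by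
    refine List.sum_eq_zero fun x hx => ?_
    obtain ⟨m, hm, rfl⟩ := List.mem_map.1 hx
    have h5 := popCount_add m (lt_of_mem_masks_seven 4 (by simp) m hm)
    have h6 := popCount_masks_seven.2.2.2 m hm
    rw [upCoeff_eq_zero (by omega), zero_mul]
  rw [h1, h2, h3, add_zero, add_zero, add_zero]
  refine congrArg List.sum (List.map_congr_left fun m hm => ?_)
  have hm' := lt_of_mem_masks_seven 3 (by simp) m hm
  have h5 := popCount_add m hm'
  have h6 := popCount_masks_seven.2.2.1 m hm
  have h7 := land_add_bits z hz m hm'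
  simp [upCoeff, h5, h6, h7, designValue, hm']

theorem slack_add_mul_le (hc : Valid c) (h8 : slack c {8} = 0) {q : ℕ} (hq : q ∈ masks 8 4) :
    slack c (toSet q) + 3 * c (toSet (partnerMask q + 384)) ≤ 3 := by
  obtain ⟨h1, h2, h3, h4⟩ := toSet_partnerMask q hq
  obtain ⟨hq', hq4⟩ := mem_masks_eight 4 (by simp) q hq
  have h3' := lt_of_mem_masks_seven 3 (by simp) _ h3
  have h5 : c (toSet (q + 256)) = c (toSet (partnerMask q + 384)) := by
    obtain h | h := h4
    · rw [h]
    · rw [h, hc.apply_compl h8 (by rw [card_toSet, h2])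
        (eight_mem_toSet (partnerMask q + 128) (by omega))]
  obtain ⟨h6, h7⟩ := hc.simple_of_mem h8 (A := toSet (q + 256))
    (by rw [card_toSet, popCount_add_high_bit q hq', hq4]) (eight_mem_toSet q hq')
  have h8 := hc.isSlack.le (toSet q) (by rw [card_toSet, hq4])
  rw [h1, h5] at h7
  rw [h5] at h6
  obtain h | h := Nat.mul_eq_zero.1 h7 <;> omega

theorem zero_point_normalized (hc : Valid c) (h8 : slack c {8} = 0) (h7 : slack c {7} ≤ 3)
    (ha : c (toSet 391) = 0) (hb : c (toSet 395) = 0) : False := by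
  have hs := hc.isSlack
  have hsum := fun z => designItems_sum_slack hc h8 (z := z)
  have hle (z : ℕ) : upSum 4 (slack c) (toSet z) ≤ 28 :=
    (upSum_mono _ (empty_subset _)).trans hs.upSum_empty.le
  have key : ∀ r ∈ designRows, (designItems.map fun q => r.coeff q.1 * designValue c q.1).sum ≤
      r.cap ∧ r.allowed.testBit (designItems.map fun q => r.coeff q.1 * designValue c q.1).sum := by
    simp only [designRows, List.forall_mem_cons, List.forall_mem_append, List.forall_mem_map]
    have hbits : (∀ n ≤ 3, Nat.testBit 15 n) ∧ (∀ n ≤ 28, n % 2 = 0 → Nat.testBit 357913941 n) ∧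
        (∀ n ≤ 27, n % 3 = 0 → Nat.testBit 153391689 n) ∧
        (∀ n ≤ 28, n % 4 = 0 → Nat.testBit 286331153 n) ∧
        (∀ n ≤ 12, n % 4 = 0 → Nat.testBit 4369 n) := by decide
    obtain ⟨b1, b2, b3, b4, b5⟩ := hbits
    refine ⟨⟨⟨⟨⟨fun z hz => ?_, fun q hq => ?_⟩, fun z hz => ?_⟩, fun z hz => ?_⟩, fun z hz => ?_⟩,
      ?_, ?_, ?_⟩
    · have hz' := lt_of_mem_masks_seven 2 (by simp) z hz
      have hcard : (toSet (z + 384)).card = 4 := by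
        rw [card_toSet, (popCount_add z hz').2.2, popCount_masks_seven.2.1 z hz]
      rw [designItems_sum_upSum hz', hc.upSum_of_mem h8 (eight_mem_toSet (z + 128) (by omega))
        hcard.le, hcard]
      decide
    · have h1 : (designItems.map fun p => ((if p.1 = q + 256 then 1 else 0) +
          if p.1 = partnerMask q then 3 else 0) * designValue c p.1).sum ≤ 3 := by
        refine le_trans ?_ (slack_add_mul_le hc h8 hq)
        have h2 := sum_ite_eq_of_nodup designItems_keys (designValue c) (q + 256) 1
        have h3 := sum_ite_eq_of_nodup designItems_keys (designValue c) (partnerMask q) 3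
        rw [List.map_map] at h2 h3
        have h4 : designValue c (q + 256) = slack c (toSet q) := by
          rw [designValue, if_neg (by omega), Nat.add_sub_cancel]
        have h5 : designValue c (partnerMask q) = c (toSet (partnerMask q + 384)) := by
          rw [designValue, if_pos
            (lt_of_mem_masks_seven 3 (by simp) _ (toSet_partnerMask q hq).2.2.1)]
        rw [h4] at h2
        rw [h5] at h3
        simp only [add_mul, List.sum_map_add]
        rw [one_mul] at h2
        exact add_le_add h2 h3
      exact ⟨h1, b1 _ h1⟩
    · obtain ⟨hz1, hz2⟩ := mem_masks_eight 3 (by simp) z hz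
      have h1 := hle z
      rw [hsum z hz1]
      refine ⟨h1, b2 _ h1 ?_⟩
      rw [hs.upSum_three (by rw [card_toSet, hz2])]
      omega
    · obtain ⟨hz1, hz2⟩ := mem_masks_eight 2 (by simp) z hz
      have h1 := hle z
      have h2 := hs.upSum_two (I := toSet z) (by rw [card_toSet, hz2])
      rw [hsum z hz1]
      exact ⟨by omega, b3 _ (by omega) (by omega)⟩
    · have hz' := lt_of_mem_masks_seven 1 (by simp) z hz
      have h1 := hle z
      rw [hsum z (by omega)]
      refine ⟨h1, b4 _ h1 ?_⟩
      rw [hs.upSum_one (by rw [card_toSet, popCount_masks_seven.1 z hz])]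
      omega
    · have h1 := hs.upSum_one (I := toSet 128) (by decide)
      rw [show toSet 128 = {7} by decide] at h1
      have h2 := hsum 128 (by norm_num)
      rw [show toSet 128 = {7} by decide] at h2
      change (designItems.map fun q => upCoeff 5 384 q.1 * designValue c q.1).sum = _ at h2
      rw [h2]
      exact ⟨by omega, b5 _ (by omega) (by omega)⟩
    · have h2 := hsum 0 (by norm_num)
      rw [toSet_zero, hs.upSum_empty, zero_add] at h2
      rw [h2]
      decide
    · simp
  have hsol : solvable designItems designRows = true := by
    refine solvable_of_solution (designValue c) _ _ ?_ ?_ ?_ ?_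
    · intro q hq
      simp only [designItems, List.mem_append, List.mem_map] at hq
      obtain (⟨m, hm, rfl⟩ | ⟨m, hm, rfl⟩) | ⟨m, hm, rfl⟩ := hq
      · have hm' := lt_of_mem_masks_seven 3 (by simp) m hm
        change designValue c m ≤ _
        rw [designValue, if_pos hm']
        split_ifs with h
        · obtain rfl | rfl := h
          · exact ha.le
          · exact hb.le
        · exact (hc.simple_of_mem h8 (by
            rw [card_toSet, (popCount_add m hm').2.2, popCount_masks_seven.2.2.1 m hm])
            (eight_mem_toSet (m + 128) (by omega))).1
      · have hm' := lt_of_mem_masks_seven 3 (by simp) m hm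
        change designValue c (m + 384) ≤ 3
        rw [designValue, if_neg (by omega), show m + 384 - 256 = m + 128 by omega]
        exact hs.le _ (by
          rw [card_toSet, (popCount_add m hm').1, popCount_masks_seven.2.2.1 m hm])
      · change designValue c (m + 256) ≤ 3
        rw [designValue, if_neg (by omega), Nat.add_sub_cancel]
        exact hs.le _ (by rw [card_toSet, popCount_masks_seven.2.2.2 m hm])
    · decide +kernel
    · exact fun r hr => (key r hr).1
    · exact fun r hr => (key r hr).2
  rw [designSystem_unsolvable] at hsol
  exact Bool.false_ne_true hsol

end

theorem upSum_comp_map (k : ℕ) (f : Finset (Fin 9) → ℕ) (σ : Equiv.Perm (Fin 9))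
    (I : Finset (Fin 9)) :
    upSum k (fun J => f (J.map σ.toEmbedding)) I = upSum k f (I.map σ.toEmbedding) :=
  sum_equiv (Equiv.finsetCongr σ) (by simp) (by simp)

theorem Valid.comp_map {c : Finset (Fin 9) → ℕ} (hc : Valid c) (σ : Equiv.Perm (Fin 9)) :
    Valid fun I => c (I.map σ.toEmbedding) where
  cov t ht := by
    rw [upSum_comp_map]
    exact hc.cov _ (by rw [card_map, ht])
  tot := by rw [upSum_comp_map, map_empty, hc.tot]

theorem slack_comp_map (c : Finset (Fin 9) → ℕ) (σ : Equiv.Perm (Fin 9)) (I : Finset (Fin 9)) :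
    slack (fun J => c (J.map σ.toEmbedding)) I = slack c (I.map σ.toEmbedding) := by
  rw [slack, slack, upSum_comp_map, card_map]

theorem Valid.zero_point_false {c : Finset (Fin 9) → ℕ} (hc : Valid c) {x y a b d e : Fin 9}
    (hinj : ![x, y, a, b, d, e].Injective) (hx : slack c {x} = 0) (hy : slack c {y} ≤ 3)
    (hd : c {d, x, y, a, b} = 0) (he : c {e, x, y, a, b} = 0) : False := by
  obtain ⟨σ, hσ⟩ := exists_perm_extending ![x, y, a, b, d, e] hinj ![8, 7, 0, 1, 2, 3] (by decide)
  have s0 : σ 8 = x := hσ 0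
  have s1 : σ 7 = y := hσ 1
  have s2 : σ 0 = a := hσ 2
  have s3 : σ 1 = b := hσ 3
  have s4 : σ 2 = d := hσ 4
  have s5 : σ 3 = e := hσ 5
  refine zero_point_normalized (hc.comp_map σ) ?_ ?_ ?_ ?_
  · simpa [slack_comp_map, s0] using hx
  · simpa [slack_comp_map, s1] using hy
  · have : toSet 391 = {2, 8, 7, 0, 1} := by decide +kernel
    simpa [this, map_insert, s0, s1, s2, s3, s4] using hd
  · have : toSet 395 = {3, 8, 7, 0, 1} := by decide +kernel
    simpa [this, map_insert, s0, s1, s2, s3, s5] using he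

theorem Valid.slack_ne_zero {c : Finset (Fin 9) → ℕ} (hc : Valid c) (x : Fin 9) :
    slack c {x} ≠ 0 := by
  intro hx
  obtain ⟨y, hyx, hy⟩ : ∃ y, y ≠ x ∧ slack c {y} ≤ 3 := by
    by_contra! hcon
    have h1 : ∑ y ∈ univ.erase x, 4 ≤ ∑ y ∈ univ.erase x, slack c {y} :=
      sum_le_sum fun y hy => hcon y (ne_of_mem_erase hy)
    have h2 := sum_erase_add univ (fun y => slack c {y}) (mem_univ x)
    rw [hc.isSlack.sum_zero] at h2
    simp at h1
    omega
  obtain ⟨I, hI, -, hI4⟩ := exists_subsuperset_card_eq (subset_univ {x, y}) (n := 4)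
    (by rw [card_pair hyx.symm]; norm_num) (by simp)
  have hxI : x ∈ I := hI (by simp)
  have hyI : y ∈ I := hI (by simp)
  obtain ⟨a, b, hab, hab'⟩ := card_eq_two.1 (show ((I.erase x).erase y).card = 2 by
    rw [card_erase_of_mem (mem_erase.2 ⟨hyx, hyI⟩), card_erase_of_mem hxI, hI4])
  have hI' : I = {x, y, a, b} := by
    rw [← hab', insert_erase (mem_erase.2 ⟨hyx, hyI⟩), insert_erase hxI]
  have hz (z) (hz : z ∈ Iᶜ) : (insert z I).card = 5 := by rw [card_insert_of_mem_compl hz, hI4]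
  obtain ⟨d, hd, e, he, hde⟩ : ∃ d ∈ Iᶜ.filter fun z => c (insert z I) = 0,
      ∃ e ∈ Iᶜ.filter fun z => c (insert z I) = 0, d ≠ e := by
    rw [← one_lt_card]
    have h1 := sum_upSum_insert 5 c I
    rw [hc.upSum_of_mem hx hxI hI4.le, hI4, sum_congr rfl fun z h => upSum_self c (hz z h)] at h1
    have h2 : ∑ z ∈ Iᶜ, c (insert z I) =
        (Iᶜ.filter fun z => c (insert z I) ≠ 0).card := by
      rw [card_filter]
      refine sum_congr rfl fun z h => ?_
      have := (hc.simple_of_mem hx (hz z h) (mem_insert_of_mem hxI)).1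
      split_ifs <;> omega
    have h3 := card_filter_add_card_filter_not (s := Iᶜ) fun z => c (insert z I) = 0
    rw [card_compl, Fintype.card_fin, hI4] at h3
    simp only [degBound] at h1
    simp only [ne_eq] at h2
    omega
  simp only [mem_filter, mem_compl] at hd he
  subst hI'
  have hxab : x ∉ ({a, b} : Finset (Fin 9)) := by rw [← hab']; simp
  have hyab : y ∉ ({a, b} : Finset (Fin 9)) := by rw [← hab']; simp
  simp only [mem_insert, mem_singleton, not_or] at hd he hxab hyab
  have hinj : Function.Injective ![x, y, a, b, d, e] := by
    rw [← List.nodup_ofFn]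
    simp
    grind
  exact hc.zero_point_false hinj hx hy hd.2 he.2

theorem four_ne_zero_iff {s : Finset (Fin 9) → ℕ} {x y z t : Fin 9} :
    four s x y z t ≠ 0 ↔ ({x, y, z, t} : Finset (Fin 9)).card = 4 ∧ s {x, y, z, t} ≠ 0 := by
  rw [four]
  split_ifs with h <;> simp [h]

theorem ne_of_card_eq_four {x y z t : Fin 9} (h : ({x, y, z, t} : Finset (Fin 9)).card = 4) :
    x ∉ ({y, z, t} : Finset (Fin 9)) ∧ y ∉ ({z, t} : Finset (Fin 9)) ∧ z ≠ t := by
  revert x y z t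
  decide +kernel

/-- A point of least slack among all valid collections has a link containing no four triples on
four points. -/
theorem Valid.linkFree {c : Finset (Fin 9) → ℕ} (hc : Valid c) {x : Fin 9}
    (hmin : ∀ c', Valid c' → slack c {x} ≤ slack c' {x}) : LinkFree (slack c) x := by
  intro p q r t h1 h2 h3
  by_contra h4
  rw [four_ne_zero_iff] at h1 h2 h3
  obtain ⟨h4, h4'⟩ := four_ne_zero_iff.1 h4
  obtain ⟨a1, b1, -⟩ := ne_of_card_eq_four h1.1
  obtain ⟨a2, b2, -⟩ := ne_of_card_eq_four h2.1
  obtain ⟨a4, b4, c4⟩ := ne_of_card_eq_four h4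
  simp only [mem_insert, mem_singleton, not_or] at a1 b1 a2 b2 a4 b4
  have hQ : ({p, q, r, t} : Finset (Fin 9)).card = 4 := by
    rw [card_insert_of_notMem (by simp; tauto), card_insert_of_notMem (by simp; tauto),
      card_pair c4]
  obtain ⟨c', hc', hlt⟩ := hc.exists_exchange (x := x) (Q := {p, q, r, t}) (by simp; tauto) hQ (by
    intro T hT hT3
    obtain ⟨u, hu, hu'⟩ := exists_mem_notMem_of_card_lt_card 
      (show T.card < ({p, q, r, t} : Finset (Fin 9)).card by omega)
    have hT' : T = ({p, q, r, t} : Finset (Fin 9)).erase u :=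
      eq_of_subset_of_card_le (subset_erase.2 ⟨hT, hu'⟩) (by rw [card_erase_of_mem hu, hQ, hT3])
    simp only [mem_insert, mem_singleton] at hu
    obtain rfl | rfl | rfl | rfl := hu
    · rwa [hT', show ({u, q, r, t} : Finset (Fin 9)).erase u = {q, r, t} by grind]
    · rw [hT', show ({p, u, r, t} : Finset (Fin 9)).erase u = {p, r, t} by grind]
      exact h3.2
    · rw [hT', show ({p, q, u, t} : Finset (Fin 9)).erase u = {p, q, t} by grind]
      exact h2.2
    · rw [hT', show ({p, q, r, u} : Finset (Fin 9)).erase u = {p, q, r} by grind]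
      exact h1.2)
  exact absurd (hmin c' hc') (by omega)

theorem not_valid (c : Finset (Fin 9) → ℕ) : ¬ Valid c := by
  intro hc
  classical
  have hex : ∃ m, ∃ c x, Valid c ∧ slack c {x} = m := ⟨_, c, 0, hc, rfl⟩
  obtain ⟨d, x, hd, hx⟩ := Nat.find_spec hex
  have hmin (c') (y) (hc' : Valid c') : Nat.find hex ≤ slack c' {y} :=
    Nat.find_min' hex ⟨c', y, hc', rfl⟩
  have hfree (y) (hy : slack d {y} = Nat.find hex) : LinkFree (slack d) y :=
    hd.linkFree fun c' hc' => hy ▸ hmin c' y hc'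
  have h9 : ∑ y : Fin 9, Nat.find hex ≤ ∑ y, slack d {y} := sum_le_sum fun y _ => hmin d y hd
  rw [hd.isSlack.sum_zero, sum_const, card_univ, Fintype.card_fin, smul_eq_mul] at h9
  have h2 := (hfree x hx).not_le_two hd.isSlack (hd.slack_ne_zero x)
  have h3 : Nat.find hex = 3 := by omega
  rw [h3] at hfree hmin
  exact hd.isSlack.not_three_le hfree fun y => hmin d y hd

theorem upSum_count {C : Multiset (Finset (Fin 9))} (hC : ∀ B ∈ C, B.card = 5)
    (t : Finset (Fin 9)) : upSum 5 (C.count ·) t = (C.filter fun B => t ⊆ B).card := by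
  rw [← Multiset.sum_count_eq_card (s := univ) fun a _ => mem_univ a, upSum, sum_filter]
  refine sum_congr rfl fun B _ => ?_
  rw [Multiset.count_filter]
  by_cases hB : B.card = 5
  · simp [hB]
  · simp [hB, Multiset.count_eq_zero_of_notMem fun h => hB (hC B h)]

/-- The masks of 69 five-element sets covering each four-element set at most three times. -/
def extremalMasks : List ℕ :=
  [31, 59, 61, 87, 91, 103, 107, 109, 117, 118, 122, 124, 143, 157, 158, 167, 171, 179, 181, 182,
   186, 199, 205, 206, 211, 214, 217, 220, 233, 234, 241, 248, 271, 279, 286, 295, 301, 307, 310,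
   313, 316, 331, 333, 341, 345, 346, 348, 355, 358, 364, 369, 370, 395, 403, 405, 409, 410, 421,
   425, 436, 440, 451, 453, 458, 466, 468, 481, 484, 496]

theorem extremalMasks_spec : extremalMasks.length = 69 ∧ (∀ m ∈ extremalMasks, popCount m = 5) ∧
    ∀ w ∈ masks 9 4, extremalMasks.countP (fun m => w &&& m = w) ≤ 3 := by
  decide +kernel

theorem exists_toSet_eq {t : Finset (Fin 9)} (ht : t.card = 4) : ∃ w ∈ masks 9 4, toSet w = t := by
  have : t ∈ univ.filter fun t : Finset (Fin 9) => t.card = 4 := by simpa using ht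
  rw [filter_card_eq (.inl rfl)] at this
  simpa using this

/-- `T_{4,4}(9) = 69`. -/
theorem stmt13 :
    (∃ C : Multiset (Finset (Fin 9)), IsTCollection 4 4 9 C ∧ Multiset.card C = 69) ∧
      ¬ ∃ C : Multiset (Finset (Fin 9)), IsTCollection 4 4 9 C ∧
          Multiset.card C = 69 + 1 := by
  constructor
  · obtain ⟨h1, h2, h3⟩ := extremalMasks_spec
    refine ⟨(extremalMasks : Multiset ℕ).map toSet, ⟨fun s hs => ?_, fun t ht => ?_⟩, by simpa⟩
    · obtain ⟨m, hm, rfl⟩ := Multiset.mem_map.1 hs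
      rw [card_toSet, h2 m hm]
    · obtain ⟨w, hw, rfl⟩ := exists_toSet_eq ht
      have hw' := (mem_masks_nine (.inl rfl) w hw).1
      rw [Multiset.filter_map, Multiset.card_map, ← Multiset.countP_eq_card_filter,
        Multiset.coe_countP]
      simpa [toSet_subset_toSet hw'] using h3 w hw
  · rintro ⟨C, ⟨h5, hC⟩, hcard⟩
    refine not_valid (C.count ·) ⟨fun t ht => ?_, ?_⟩
    · rw [upSum_count h5]
      exact hC t ht
    · rw [upSum_count h5]
      simpa using hcard
end
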